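/- Let u be a Lipschitz solution of either the thin obstacle problem in B₁ or the boundary (Signorini) obstacle problem in B₁⁺, with F, F₀ satisfying (H0) and (H1). Then for every z₀ ∈ Γ(u) there exists a_{z₀} ∈ ℝ such that the rescalings u_t(x) := u(z₀ + t x)/t converge uniformly (on B₁, respectively B₁⁺) to the linear function a_{z₀}·x_{n+1} as t → 0⁺; in particular u is differentiable at z₀ (relative to its domain) with ∇u(z₀) = (0, a_{z₀}) ∈ ℝⁿ × ℝ. -/

import Mathlib

open MeasureTheory Metric Filter
open scoped InnerProductSpace NNReal ENNReal Topology

noncomputable section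

/-- Euclidean space `ℝ^{n+1}`. -/
abbrev Eucl (n : ℕ) : Type := EuclideanSpace ℝ (Fin (n + 1))

namespace TOP

variable {n : ℕ}

/-- The `(n+1)`-st standard basis vector `e_{n+1}`. -/
def eLast (n : ℕ) : Eucl n := EuclideanSpace.single (Fin.last n) 1

/-- Open upper half ball `B_r⁺(x₀)`. -/
def hBall (x₀ : Eucl n) (r : ℝ) : Set (Eucl n) :=
  Metric.ball x₀ r ∩ {x : Eucl n | 0 < x (Fin.last n)}

/-- Open lower half ball `B_r⁻(x₀)`. -/
def hBallNeg (x₀ : Eucl n) (r : ℝ) : Set (Eucl n) :=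
  Metric.ball x₀ r ∩ {x : Eucl n | x (Fin.last n) < 0}

/-- Thin ball `B_r'(x₀)`. -/
def tBall (x₀ : Eucl n) (r : ℝ) : Set (Eucl n) :=
  Metric.ball x₀ r ∩ {x : Eucl n | x (Fin.last n) = 0}

/-- (H0): `F` and `F₀` are of class `C¹` on `B₁ × ℝ × ℝ^{n+1}`. -/
def H0 (F : Eucl n → ℝ → Eucl n → Eucl n) (F₀ : Eucl n → ℝ → Eucl n → ℝ) : Prop :=
  ContDiffOn ℝ 1 (fun q : Eucl n × ℝ × Eucl n => F q.1 q.2.1 q.2.2)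
      (Metric.ball (0 : Eucl n) 1 ×ˢ (Set.univ : Set ℝ) ×ˢ (Set.univ : Set (Eucl n))) ∧
    ContDiffOn ℝ 1 (fun q : Eucl n × ℝ × Eucl n => F₀ q.1 q.2.1 q.2.2)
      (Metric.ball (0 : Eucl n) 1 ×ˢ (Set.univ : Set ℝ) ×ˢ (Set.univ : Set (Eucl n)))

/-- (H1): uniform ellipticity of `D_pF` on compact subsets. -/
def H1 (F : Eucl n → ℝ → Eucl n → Eucl n) : Prop :=
  ∀ M : ℝ, 0 < M → ∃ lam : ℝ, 0 < lam ∧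
    ∀ x ∈ Metric.ball (0 : Eucl n) 1, ∀ z : ℝ, |z| ≤ M → ∀ p : Eucl n, ‖p‖ ≤ M →
      ∀ ξ : Eucl n, lam * ‖ξ‖ ^ 2 ≤ ⟪fderiv ℝ (F x z) p ξ, ξ⟫_ℝ

/-- (H1) with a prescribed ellipticity function `lam : M ↦ λ(M)`. -/
def H1With (lam : ℝ → ℝ) (F : Eucl n → ℝ → Eucl n → Eucl n) : Prop :=
  ∀ M : ℝ, 0 < M → 0 < lam M ∧
    ∀ x ∈ Metric.ball (0 : Eucl n) 1, ∀ z : ℝ, |z| ≤ M → ∀ p : Eucl n, ‖p‖ ≤ M →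
      ∀ ξ : Eucl n, lam M * ‖ξ‖ ^ 2 ≤ ⟪fderiv ℝ (F x z) p ξ, ξ⟫_ℝ

/-- `div_x F (x, z, p) = ∑ᵢ ∂_{xᵢ} Fᵢ (x, z, p)`. -/
def divx (F : Eucl n → ℝ → Eucl n → Eucl n) (x : Eucl n) (z : ℝ) (p : Eucl n) : ℝ :=
  ∑ i : Fin (n + 1), fderiv ℝ (fun y : Eucl n => F y z p i) x (EuclideanSpace.single i 1)

/-- `(F, F₀)` is `t`-rescaled with bound function `L : M ↦ L(M)`. -/
def Rescaled (t : ℝ) (L : ℝ → ℝ) (F : Eucl n → ℝ → Eucl n → Eucl n)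
    (F₀ : Eucl n → ℝ → Eucl n → ℝ) : Prop :=
  ∀ M : ℝ, 0 < M → ∀ x ∈ Metric.ball (0 : Eucl n) 1, ∀ z : ℝ, |z| ≤ M →
    ∀ p : Eucl n, ‖p‖ ≤ M →
      |(- divx F x z p - ⟪deriv (fun s : ℝ => F x s p) z, p⟫_ℝ + F₀ x z p)| ≤ t * L M ∧
        ‖fderiv ℝ (F x z) p‖ ≤ L M

/-- The operator `H_t` acting classically on a `C²` function `φ`:
`H_t(φ)(x) = −div_x F − ⟨∂_z F, ∇φ⟩ − tr(D_pF · D²φ) + F₀`, all evaluated at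
`(x, φ(x), ∇φ(x))`. -/
def Hop (F : Eucl n → ℝ → Eucl n → Eucl n) (F₀ : Eucl n → ℝ → Eucl n → ℝ)
    (φ : Eucl n → ℝ) (x : Eucl n) : ℝ :=
  - divx F x (φ x) (gradient φ x)
    - ⟪deriv (fun s : ℝ => F x s (gradient φ x)) (φ x), gradient φ x⟫_ℝ
    - ∑ i : Fin (n + 1),
        ⟪fderiv ℝ (F x (φ x)) (gradient φ x)
          (fderiv ℝ (gradient φ) x (EuclideanSpace.single i 1)), EuclideanSpace.single i 1⟫_ℝ
    + F₀ x (φ x) (gradient φ x)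

/-- The admissible class `A_g` for the thin obstacle problem: `W^{1,∞}(B₁)` functions
with boundary value `g` on `∂B₁` which are nonnegative on `B₁'`. -/
def AdmissibleThin (g v : Eucl n → ℝ) : Prop :=
  (∃ C : ℝ≥0, LipschitzOnWith C v (Metric.closedBall (0 : Eucl n) 1)) ∧
    (∀ x ∈ Metric.sphere (0 : Eucl n) 1, v x = g x) ∧
    ∀ x ∈ tBall (0 : Eucl n) 1, 0 ≤ v x

/-- A (Lipschitz) solution of the thin obstacle problem in `B₁`. -/
def ThinSolution (F : Eucl n → ℝ → Eucl n → Eucl n) (F₀ : Eucl n → ℝ → Eucl n → ℝ)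
    (g u : Eucl n → ℝ) : Prop :=
  AdmissibleThin g u ∧
    ∀ v : Eucl n → ℝ, AdmissibleThin g v →
      0 ≤ ∫ x in Metric.ball (0 : Eucl n) 1,
        (⟪F x (u x) (gradient u x), gradient v x - gradient u x⟫_ℝ +
          F₀ x (u x) (gradient u x) * (v x - u x))

/-- The admissible class `A_g` for the boundary (Signorini) obstacle problem:
`W^{1,∞}(B₁⁺)` functions with boundary value `g` on `∂B₁⁺ ∖ B₁'` which are
nonnegative on `B₁'`. -/
def AdmissibleBdry (g v : Eucl n → ℝ) : Prop :=
  (∃ C : ℝ≥0, LipschitzOnWith C v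
      (Metric.closedBall (0 : Eucl n) 1 ∩ {x : Eucl n | 0 ≤ x (Fin.last n)})) ∧
    (∀ x : Eucl n, ‖x‖ = 1 → 0 ≤ x (Fin.last n) → v x = g x) ∧
    ∀ x ∈ tBall (0 : Eucl n) 1, 0 ≤ v x

/-- A (Lipschitz) solution of the boundary (Signorini) obstacle problem in `B₁⁺`. -/
def BdrySolution (F : Eucl n → ℝ → Eucl n → Eucl n) (F₀ : Eucl n → ℝ → Eucl n → ℝ)
    (g u : Eucl n → ℝ) : Prop :=
  AdmissibleBdry g u ∧
    ∀ v : Eucl n → ℝ, AdmissibleBdry g v →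
      0 ≤ ∫ x in hBall (0 : Eucl n) 1,
        (⟪F x (u x) (gradient u x), gradient v x - gradient u x⟫_ℝ +
          F₀ x (u x) (gradient u x) * (v x - u x))

/-- The coincidence set `Λ(u) = {x ∈ B₁' : u(x) = 0}`. -/
def coincidenceSet (u : Eucl n → ℝ) : Set (Eucl n) :=
  {x ∈ tBall (0 : Eucl n) 1 | u x = 0}

/-- The free boundary `Γ(u)`: the boundary of `Λ(u)` in the relative topology of `B₁'`. -/
def freeBoundary (u : Eucl n → ℝ) : Set (Eucl n) :=
  {x ∈ coincidenceSet u |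
    ∀ r : ℝ, 0 < r → ∃ y ∈ tBall (0 : Eucl n) 1, y ∈ Metric.ball x r ∧ 0 < u y}

/-- `w` satisfies the Caccioppoli inequality with constant `Q` at `x₀ ∈ B₁'`. -/
def CaccAt (w : Eucl n → ℝ) (Q : ℝ) (x₀ : Eucl n) : Prop :=
  ∀ k : ℝ, 0 ≤ k → ∀ r R : ℝ, 0 < r → r < R → R < 1 - ‖x₀‖ →
    (∫ x in ({x : Eucl n | k ≤ w x} ∩ hBall x₀ r), ‖gradient w x‖ ^ 2) ≤
      Q / (R - r) ^ 2 * (∫ x in ({x : Eucl n | k ≤ w x} ∩ hBall x₀ R), (w x - k) ^ 2) +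
        Q * (volume ({x : Eucl n | k ≤ w x} ∩ hBall x₀ R)).toReal

/-- Difference quotient `D_e^h w (x) = (w(x + h e) − w(x))/h`. -/
def diffQuot (h : ℝ) (e : Eucl n) (w : Eucl n → ℝ) (x : Eucl n) : ℝ :=
  (w (x + h • e) - w x) / h

/-- The barrier function `η(x) = t(|x' − x₀'|² − K x_{n+1}²) + m x_{n+1} + γ`. -/
def etaFn (x₀ : Eucl n) (t K m γ : ℝ) (x : Eucl n) : ℝ :=
  t * ((∑ i : Fin n, (x i.castSucc - x₀ i.castSucc) ^ 2) - K * (x (Fin.last n)) ^ 2) +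
    m * x (Fin.last n) + γ

end TOP

namespace TOP

variable {n : ℕ}

/-- A structure function viewed as a function on the product space. -/
def uncurried (F : Eucl n → ℝ → Eucl n → Eucl n) (q : Eucl n × ℝ × Eucl n) : Eucl n :=
  F q.1 q.2.1 q.2.2

theorem isOpen_structure_domain :
    IsOpen (ball (0 : Eucl n) 1 ×ˢ (Set.univ : Set ℝ) ×ˢ (Set.univ : Set (Eucl n))) :=
  isOpen_ball.prod (isOpen_univ.prod isOpen_univ)

theorem contDiffOn_uncurried {F : Eucl n → ℝ → Eucl n → Eucl n}
    {F₀ : Eucl n → ℝ → Eucl n → ℝ} (hF : H0 F F₀) : ContDiffOn ℝ 1 (uncurried F)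
      (ball (0 : Eucl n) 1 ×ˢ (Set.univ : Set ℝ) ×ˢ (Set.univ : Set (Eucl n))) :=
  hF.1

theorem exists_structure_bound {F : Eucl n → ℝ → Eucl n → Eucl n} {F₀ : Eucl n → ℝ → Eucl n → ℝ}
    (hF : H0 F F₀) {z₀ : Eucl n} {r : ℝ} (hr : closedBall z₀ r ⊆ ball (0 : Eucl n) 1) (M : ℝ) :
    ∃ B : ℝ, 0 < B ∧ ∀ x ∈ closedBall z₀ r, ∀ z : ℝ, |z| ≤ M → ∀ p : Eucl n, ‖p‖ ≤ M →
      ‖fderiv ℝ (uncurried F) (x, z, p)‖ ≤ B ∧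
        ‖F x z p‖ ≤ B ∧ |F₀ x z p| ≤ B := by
  set K : Set (Eucl n × ℝ × Eucl n) :=
    closedBall z₀ r ×ˢ closedBall (0 : ℝ) M ×ˢ closedBall (0 : Eucl n) M
  have hK : IsCompact K := (isCompact_closedBall _ _).prod
    ((isCompact_closedBall _ _).prod (isCompact_closedBall _ _))
  have hKs : K ⊆ ball (0 : Eucl n) 1 ×ˢ (Set.univ : Set ℝ) ×ˢ (Set.univ : Set (Eucl n)) :=
    fun q hq => ⟨hr hq.1, trivial, trivial⟩
  obtain ⟨B₁, h₁⟩ := hK.exists_bound_of_continuousOn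
    (((contDiffOn_uncurried hF).continuousOn_fderiv_of_isOpen isOpen_structure_domain
      le_rfl).mono hKs)
  obtain ⟨B₂, h₂⟩ := hK.exists_bound_of_continuousOn
    ((contDiffOn_uncurried hF).continuousOn.mono hKs)
  obtain ⟨B₃, h₃⟩ := hK.exists_bound_of_continuousOn (hF.2.continuousOn.mono hKs)
  refine ⟨max B₁ (max B₂ (max B₃ 1)), by positivity, fun x hx z hz p hp => ?_⟩
  have hq : (x, z, p) ∈ K := ⟨hx, by simpa using hz, by simpa using hp⟩
  refine ⟨(h₁ _ hq).trans (by simp), (h₂ _ hq).trans (by simp), ?_⟩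
  exact (h₃ _ hq).trans (by simp)

theorem hasFDerivAt_structure {F : Eucl n → ℝ → Eucl n → Eucl n} {F₀ : Eucl n → ℝ → Eucl n → ℝ}
    (hF : H0 F F₀) {x : Eucl n} (hx : x ∈ ball (0 : Eucl n) 1) (z : ℝ) (p : Eucl n) :
    HasFDerivAt (uncurried F) (fderiv ℝ (uncurried F) (x, z, p)) (x, z, p) := by
  have hn : ball (0 : Eucl n) 1 ×ˢ (Set.univ : Set ℝ) ×ˢ (Set.univ : Set (Eucl n)) ∈
      𝓝 (x, z, p) := isOpen_structure_domain.mem_nhds ⟨hx, trivial, trivial⟩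
  exact (((contDiffOn_uncurried hF).differentiableOn one_ne_zero).differentiableAt hn).hasFDerivAt

theorem fderiv_structure_snd {F : Eucl n → ℝ → Eucl n → Eucl n} {F₀ : Eucl n → ℝ → Eucl n → ℝ}
    (hF : H0 F F₀) {x : Eucl n} (hx : x ∈ ball (0 : Eucl n) 1) (z : ℝ) (p : Eucl n) :
    HasFDerivAt (F x z) (fderiv ℝ (F x z) p) p ∧ ∀ ξ, fderiv ℝ (F x z) p ξ =
      fderiv ℝ (uncurried F) (x, z, p) (0, 0, ξ) := by
  have h1 : HasFDerivAt (fun p' : Eucl n => ((x, z, p') : Eucl n × ℝ × Eucl n))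
      ((0 : Eucl n →L[ℝ] Eucl n).prod ((0 : Eucl n →L[ℝ] ℝ).prod (.id ℝ _))) p :=
    (hasFDerivAt_const _ _).prodMk ((hasFDerivAt_const _ _).prodMk (hasFDerivAt_id _))
  have h2 : HasFDerivAt (F x z) ((fderiv ℝ (uncurried F) (x, z, p)).comp
      ((0 : Eucl n →L[ℝ] Eucl n).prod ((0 : Eucl n →L[ℝ] ℝ).prod (.id ℝ _)))) p :=
    HasFDerivAt.comp (g := uncurried F) p (hasFDerivAt_structure hF hx z p) h1
  refine ⟨h2.differentiableAt.hasFDerivAt, fun ξ => ?_⟩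
  rw [h2.fderiv]; simp

theorem structure_monotone {F : Eucl n → ℝ → Eucl n → Eucl n} {F₀ : Eucl n → ℝ → Eucl n → ℝ}
    (hF : H0 F F₀) (hell : H1 F) {x : Eucl n} (hx : x ∈ ball (0 : Eucl n) 1) (z : ℝ)
    (p q : Eucl n) : 0 ≤ ⟪F x z p - F x z q, p - q⟫_ℝ := by
  set f : ℝ → ℝ := fun s => ⟪F x z (q + s • (p - q)), p - q⟫_ℝ
  have hd : ∀ s, HasDerivAt f ⟪fderiv ℝ (F x z) (q + s • (p - q)) (p - q), p - q⟫_ℝ s := by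
    intro s
    have h1 : HasDerivAt (fun s : ℝ => q + s • (p - q)) (p - q) s := by
      simpa using ((hasDerivAt_id s).smul_const (p - q)).const_add q
    have h2 := (fderiv_structure_snd hF hx z (q + s • (p - q))).1.comp_hasDerivAt s h1
    simpa using h2.inner ℝ (hasDerivAt_const s (p - q))
  have hmono : Monotone f := by
    refine monotone_of_deriv_nonneg (fun s => (hd s).differentiableAt) fun s => ?_
    rw [(hd s).deriv]
    obtain ⟨lam, hl, h⟩ := hell (max 1 (max |z| ‖q + s • (p - q)‖)) (by simp)
    exact le_trans (by positivity) (h x hx z (by simp) _ (by simp) (p - q))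
  have := hmono zero_le_one
  simp only [f, zero_smul, add_zero, one_smul, add_sub_cancel] at this
  rw [inner_sub_left]; linarith

theorem structure_lipschitz_value {F : Eucl n → ℝ → Eucl n → Eucl n}
    {F₀ : Eucl n → ℝ → Eucl n → ℝ} (hF : H0 F F₀) {x p : Eucl n} {M B : ℝ}
    (hx : x ∈ ball (0 : Eucl n) 1)
    (hB : ∀ z : ℝ, |z| ≤ M →
      ‖fderiv ℝ (uncurried F) (x, z, p)‖ ≤ B)
    {z z' : ℝ} (hz : |z| ≤ M) (hz' : |z'| ≤ M) :
    ‖F x z p - F x z' p‖ ≤ B * |z - z'| := by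
  have key : ∀ s ∈ closedBall (0 : ℝ) M, HasFDerivWithinAt (fun s => F x s p)
      ((fderiv ℝ (uncurried F) (x, s, p)).comp
        ((0 : ℝ →L[ℝ] Eucl n).prod ((ContinuousLinearMap.id ℝ ℝ).prod 0)))
      (closedBall (0 : ℝ) M) s := by
    intro s _
    have h1 : HasFDerivAt (fun s : ℝ => ((x, s, p) : Eucl n × ℝ × Eucl n))
        ((0 : ℝ →L[ℝ] Eucl n).prod ((ContinuousLinearMap.id ℝ ℝ).prod 0)) s :=
      (hasFDerivAt_const _ _).prodMk ((hasFDerivAt_id _).prodMk (hasFDerivAt_const _ _))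
    exact (HasFDerivAt.comp (g := uncurried F) s
      (hasFDerivAt_structure hF hx s p) h1).hasFDerivWithinAt
  refine (convex_closedBall (0 : ℝ) M).norm_image_sub_le_of_norm_hasFDerivWithin_le key ?_
    (by simpa using hz') (by simpa using hz)
  intro s hs
  have hs' : |s| ≤ M := by simpa using hs
  have hB0 : 0 ≤ B := (norm_nonneg _).trans (hB s hs')
  refine ContinuousLinearMap.opNorm_le_bound _ hB0 fun t => ?_
  rw [ContinuousLinearMap.comp_apply]
  refine (ContinuousLinearMap.le_opNorm _ _).trans ?_
  refine mul_le_mul (hB s hs') ?_ (norm_nonneg _) hB0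
  simp

/-- Integration by parts for a `C¹` function against a Lipschitz function supported in a ball. -/
theorem integral_fderiv_mul_add_eq_zero {f ψ : Eucl n → ℝ} {z₀ : Eucl n} {r : ℝ} {C : ℝ≥0}
    {U : Set (Eucl n)} (hU : IsOpen U) (hrU : closedBall z₀ r ⊆ U)
    (hf : ContDiffOn ℝ 1 f U) (hψ : LipschitzWith C ψ) (hs : tsupport ψ ⊆ ball z₀ r) (v : Eucl n) :
    Integrable (fun x => f x * fderiv ℝ ψ x v + fderiv ℝ f x v * ψ x) ∧
      ∫ x, (f x * fderiv ℝ ψ x v + fderiv ℝ f x v * ψ x) = 0 := by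
  have hK := isCompact_closedBall z₀ r
  have hψc : HasCompactSupport ψ :=
    hK.of_isClosed_subset (isClosed_tsupport ψ) (hs.trans ball_subset_closedBall)
  obtain ⟨L, hL⟩ := ((hf.mono hrU).locallyLipschitzOn
    (convex_closedBall z₀ r)).exists_lipschitzOnWith_of_compact hK
  obtain ⟨f', hf', hff'⟩ := hL.extend_real
  have hfd : ∀ x ∈ ball z₀ r, lineDeriv ℝ f' x v = fderiv ℝ f x v := by
    intro x hx
    have heq : f' =ᶠ[𝓝 x] f := by
      filter_upwards [isOpen_ball.mem_nhds hx] with y hy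
      exact (hff' (ball_subset_closedBall hy)).symm
    have hd : DifferentiableAt ℝ f x := (hf.differentiableOn one_ne_zero).differentiableAt
      (hU.mem_nhds (hrU (ball_subset_closedBall hx)))
    rw [← heq.fderiv_eq]
    exact (hd.congr_of_eventuallyEq heq).lineDeriv_eq_fderiv
  have hout : ∀ x ∉ tsupport ψ, ψ x = 0 ∧ fderiv ℝ ψ x = 0 := fun x hx =>
    ⟨image_eq_zero_of_notMem_tsupport hx,
      Function.notMem_support.1 fun h => hx (support_fderiv_subset ℝ h)⟩
  have hae : (fun x => f x * fderiv ℝ ψ x v + fderiv ℝ f x v * ψ x) =ᵐ[volume]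
      fun x => f' x * lineDeriv ℝ ψ x v + lineDeriv ℝ f' x v * ψ x := by
    filter_upwards [hψ.ae_differentiableAt] with x hx
    rw [hx.lineDeriv_eq_fderiv]
    by_cases hxs : x ∈ tsupport ψ
    · rw [hff' (ball_subset_closedBall (hs hxs)), hfd x (hs hxs)]
    · simp [hout x hxs]
  have hi2 : Integrable (fun x => lineDeriv ℝ f' x v * ψ x) := by
    have h1 : Integrable ψ := hψ.continuous.integrable_of_hasCompactSupport hψc
    refine h1.bdd_mul (c := L * ‖v‖) (aestronglyMeasurable_lineDeriv hf'.continuous volume) ?_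
    exact .of_forall fun x => norm_lineDeriv_le_of_lipschitz ℝ hf'
  have hi1 : Integrable (fun x => f' x * lineDeriv ℝ ψ x v) := by
    have h1 : Integrable ((tsupport ψ).indicator f') := by
      rw [integrable_indicator_iff hψc.isClosed.measurableSet]
      exact hf'.continuous.continuousOn.integrableOn_compact hψc
    have h2 := h1.mul_bdd (c := C * ‖v‖)
      (aestronglyMeasurable_lineDeriv (𝕜 := ℝ) (v := v) hψ.continuous volume)
      (.of_forall fun x => norm_lineDeriv_le_of_lipschitz ℝ hψ)
    refine h2.congr ?_
    filter_upwards [hψ.ae_differentiableAt] with x hx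
    by_cases hxs : x ∈ tsupport ψ
    · simp [hxs]
    · simp [hxs, hx.lineDeriv_eq_fderiv, hout x hxs]
  refine ⟨(hi1.add hi2).congr hae.symm, ?_⟩
  rw [integral_congr_ae hae, integral_add hi1 hi2, hf'.integral_lineDeriv_mul_eq hψ hψc v]
  rw [← integral_add hi1 (by simpa [lineDeriv_neg, mul_comm] using hi1.neg)]
  simp [lineDeriv_neg, mul_comm]

/-- The trace of a continuous endomorphism of `ℝ^{n+1}`. -/
def ctrace (A : Eucl n →L[ℝ] Eucl n) : ℝ :=
  ∑ i : Fin (n + 1), ⟪A (EuclideanSpace.single i 1), EuclideanSpace.single i (1 : ℝ)⟫_ℝ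

theorem sum_coord_smul_single (v : Eucl n) :
    ∑ i : Fin (n + 1), v i • (EuclideanSpace.single i (1 : ℝ) : Eucl n) = v := by
  simpa using (EuclideanSpace.basisFun (Fin (n + 1)) ℝ).sum_repr v

theorem abs_ctrace_le (A : Eucl n →L[ℝ] Eucl n) : |ctrace A| ≤ (n + 1) * ‖A‖ := by
  have h : ∀ i : Fin (n + 1),
      |⟪A (EuclideanSpace.single i 1), EuclideanSpace.single i (1 : ℝ)⟫_ℝ| ≤ ‖A‖ := fun i => by
    refine (abs_real_inner_le_norm _ _).trans ?_
    simpa using A.le_opNorm (EuclideanSpace.single i (1 : ℝ))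
  refine (Finset.abs_sum_le_sum_abs _ _).trans ((Finset.sum_le_sum fun i _ => h i).trans ?_)
  simp

theorem ctrace_comp_rankOne (A : Eucl n →L[ℝ] Eucl n) (v : Eucl n) :
    ctrace (A.comp ((innerSL ℝ v).smulRight v)) = ⟪A v, v⟫_ℝ := by
  simp only [ctrace, ContinuousLinearMap.comp_apply, ContinuousLinearMap.smulRight_apply,
    innerSL_apply_apply, map_smul, inner_smul_left]
  conv_rhs => rw [← sum_coord_smul_single v, inner_sum]
  rw [sum_coord_smul_single v]
  refine Finset.sum_congr rfl fun i _ => ?_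
  simp [inner_smul_right, EuclideanSpace.inner_single_right]

/-- Integration by parts for a `C¹` vector field against a Lipschitz function supported in a
ball. -/
theorem integral_inner_gradient_add_eq_zero {G : Eucl n → Eucl n} {ψ : Eucl n → ℝ} {z₀ : Eucl n}
    {r : ℝ} {C : ℝ≥0} {U : Set (Eucl n)} (hU : IsOpen U) (hrU : closedBall z₀ r ⊆ U)
    (hG : ContDiffOn ℝ 1 G U) (hψ : LipschitzWith C ψ) (hs : tsupport ψ ⊆ ball z₀ r) :
    Integrable (fun x => ⟪G x, gradient ψ x⟫_ℝ + ctrace (fderiv ℝ G x) * ψ x) ∧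
      ∫ x, (⟪G x, gradient ψ x⟫_ℝ + ctrace (fderiv ℝ G x) * ψ x) = 0 := by
  have hi : ∀ i : Fin (n + 1), ContDiffOn ℝ 1 (fun x => G x i) U := fun i =>
    (contDiffOn_euclidean.1 hG) i
  have h := fun i => integral_fderiv_mul_add_eq_zero hU hrU (hi i) hψ hs
    (EuclideanSpace.single i 1)
  have heq : (fun x => ⟪G x, gradient ψ x⟫_ℝ + ctrace (fderiv ℝ G x) * ψ x) = fun x =>
      ∑ i : Fin (n + 1), (G x i * fderiv ℝ ψ x (EuclideanSpace.single i 1) +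
        fderiv ℝ (fun x => G x i) x (EuclideanSpace.single i 1) * ψ x) := by
    funext x
    rw [Finset.sum_add_distrib]
    congr 1
    · conv_lhs => rw [← sum_coord_smul_single (G x)]
      rw [inner_gradient_right]
      simp
    · rw [ctrace, Finset.sum_mul]
      refine Finset.sum_congr rfl fun i _ => ?_
      by_cases hx : x ∈ tsupport ψ
      · have hd : DifferentiableAt ℝ G x := (hG.differentiableOn one_ne_zero).differentiableAt
          (hU.mem_nhds (hrU (ball_subset_closedBall (hs hx))))
        have h2 : HasFDerivAt (fun x => G x i)
            ((EuclideanSpace.proj i : Eucl n →L[ℝ] ℝ).comp (fderiv ℝ G x)) x :=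
          (EuclideanSpace.proj i : Eucl n →L[ℝ] ℝ).hasFDerivAt.comp x hd.hasFDerivAt
        rw [h2.fderiv]
        simp [EuclideanSpace.inner_single_right]
      · simp [image_eq_zero_of_notMem_tsupport hx]
  rw [heq]
  refine ⟨integrable_finsetSum _ fun i _ => (h i).1, ?_⟩
  rw [integral_finsetSum _ fun i _ => (h i).1]
  simp [(h _).2]

theorem norm_gradient_le_of_lipschitzWith {w : Eucl n → ℝ} {C : ℝ≥0} (hw : LipschitzWith C w)
    (x : Eucl n) : ‖gradient w x‖ ≤ C := by
  simpa [gradient] using norm_fderiv_le_of_lipschitz ℝ hw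

theorem measurable_gradient (w : Eucl n → ℝ) : Measurable (gradient w) :=
  (InnerProductSpace.toDual ℝ (Eucl n)).symm.continuous.measurable.comp (measurable_fderiv ℝ w)

theorem gradient_eq_zero_of_notMem_tsupport {ψ : Eucl n → ℝ} {x : Eucl n} (hx : x ∉ tsupport ψ) :
    gradient ψ x = 0 := by
  have : fderiv ℝ ψ x = 0 := Function.notMem_support.1 fun h => hx (support_fderiv_subset ℝ h)
  simp [gradient, this]

/-- The integrand of the weak formulation, for the function `w` tested against `ψ`. -/
def weakIntegrand (F : Eucl n → ℝ → Eucl n → Eucl n) (F₀ : Eucl n → ℝ → Eucl n → ℝ)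
    (w ψ : Eucl n → ℝ) (x : Eucl n) : ℝ :=
  ⟪F x (w x) (gradient w x), gradient ψ x⟫_ℝ + F₀ x (w x) (gradient w x) * ψ x

theorem integrable_weakIntegrand {F : Eucl n → ℝ → Eucl n → Eucl n}
    {F₀ : Eucl n → ℝ → Eucl n → ℝ} (hF : H0 F F₀) {z₀ : Eucl n} {r : ℝ}
    (hr : closedBall z₀ r ⊆ ball (0 : Eucl n) 1) {w ψ : Eucl n → ℝ} {L C : ℝ≥0}
    (hw : LipschitzWith L w) (hψ : LipschitzWith C ψ) (hs : tsupport ψ ⊆ ball z₀ r) :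
    Integrable (weakIntegrand F F₀ w ψ) := by
  have hK := isCompact_closedBall z₀ r
  have hsK : tsupport ψ ⊆ closedBall z₀ r := hs.trans ball_subset_closedBall
  have hψc : IsCompact (tsupport ψ) := hK.of_isClosed_subset (isClosed_tsupport ψ) hsK
  obtain ⟨M₁, hM₁⟩ := hK.exists_bound_of_continuousOn hw.continuous.continuousOn
  obtain ⟨M₂, hM₂⟩ := hK.exists_bound_of_continuousOn hψ.continuous.continuousOn
  obtain ⟨B, hB0, hB⟩ := exists_structure_bound hF hr (max M₁ L)
  classical
  have hmeas : ∀ {V : Type} [TopologicalSpace V] [MeasurableSpace V] [BorelSpace V] [Zero V]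
      (Φ : Eucl n × ℝ × Eucl n → V), ContinuousOn Φ
        (ball (0 : Eucl n) 1 ×ˢ (Set.univ : Set ℝ) ×ˢ (Set.univ : Set (Eucl n))) →
      Measurable fun x => (ball (0 : Eucl n) 1 ×ˢ (Set.univ : Set ℝ) ×ˢ
        (Set.univ : Set (Eucl n))).piecewise Φ (fun _ => 0) (x, w x, gradient w x) := by
    intro V _ _ _ _ Φ hΦ
    refine (hΦ.measurable_piecewise continuousOn_const
      isOpen_structure_domain.measurableSet).comp ?_
    exact measurable_id.prodMk (hw.continuous.measurable.prodMk (measurable_gradient w))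
  have h1 := (hmeas _ hF.1.continuousOn).inner (𝕜 := ℝ) (measurable_gradient ψ)
  have h2 := (hmeas _ hF.2.continuousOn).mul hψ.continuous.measurable
  have hm := (h1.add h2).indicator hψc.isClosed.measurableSet
  have heq : weakIntegrand F F₀ w ψ = (tsupport ψ).indicator (weakIntegrand F F₀ w ψ) := by
    funext x
    by_cases hx : x ∈ tsupport ψ
    · simp [hx]
    · simp [hx, weakIntegrand, gradient_eq_zero_of_notMem_tsupport hx,
        image_eq_zero_of_notMem_tsupport hx]
  have hm' : Measurable (weakIntegrand F F₀ w ψ) := by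
    convert! hm using 1
    funext x
    by_cases hx : x ∈ tsupport ψ
    · have hx1 : ‖x‖ < 1 := by simpa using hr (hsK hx)
      simp [hx, weakIntegrand, Set.piecewise, hx1]
    · simp [hx, weakIntegrand, gradient_eq_zero_of_notMem_tsupport hx,
        image_eq_zero_of_notMem_tsupport hx]
  rw [heq, integrable_indicator_iff hψc.isClosed.measurableSet]
  refine Measure.integrableOn_of_bounded (M := B * C + B * M₂) hψc.measure_lt_top.ne
    hm'.aestronglyMeasurable ?_
  refine (ae_restrict_iff' hψc.isClosed.measurableSet).2 (.of_forall fun x hx => ?_)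
  have hb := hB x (hsK hx) (w x) ((hM₁ x (hsK hx)).trans (le_max_left _ _)) (gradient w x)
    ((norm_gradient_le_of_lipschitzWith hw x).trans (le_max_right _ _))
  refine (norm_add_le _ _).trans (add_le_add ?_ ?_)
  · refine (norm_inner_le_norm _ _).trans ?_
    exact mul_le_mul hb.2.1 (norm_gradient_le_of_lipschitzWith hψ x) (norm_nonneg _) hB0.le
  · rw [norm_mul]
    exact mul_le_mul hb.2.2 (hM₂ x (hsK hx)) (norm_nonneg _) hB0.le

theorem contDiff_one_of_hasGradientAt {η : Eucl n → ℝ} {g : Eucl n → Eucl n}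
    (hη : ∀ x, HasGradientAt η (g x) x) (hg : Continuous g) : ContDiff ℝ 1 η := by
  rw [contDiff_one_iff_fderiv]
  refine ⟨fun x => (hη x).differentiableAt, ?_⟩
  have : fderiv ℝ η = fun x => InnerProductSpace.toDual ℝ (Eucl n) (g x) :=
    funext fun x => (hη x).hasFDerivAt.fderiv
  rw [this]
  exact (InnerProductSpace.toDual ℝ (Eucl n)).continuous.comp hg

theorem contDiff_one_of_hasFDerivAt {V W : Type*} [NormedAddCommGroup V] [NormedSpace ℝ V]
    [NormedAddCommGroup W] [NormedSpace ℝ W] {g : V → W} {H : V → V →L[ℝ] W}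
    (hg : ∀ x, HasFDerivAt g (H x) x) (hH : Continuous H) : ContDiff ℝ 1 g := by
  rw [contDiff_one_iff_fderiv]
  refine ⟨fun x => (hg x).differentiableAt, ?_⟩
  have : fderiv ℝ g = H := funext fun x => (hg x).fderiv
  rwa [this]

/-- The divergence of `x ↦ F(x, η(x), ∇η(x))` is bounded below by its second order part up to a
constant. -/
theorem le_ctrace_fderiv_structure {F : Eucl n → ℝ → Eucl n → Eucl n}
    {F₀ : Eucl n → ℝ → Eucl n → ℝ} (hF : H0 F F₀) {η : Eucl n → ℝ} {g : Eucl n → Eucl n}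
    {H : Eucl n → Eucl n →L[ℝ] Eucl n} (hη : ∀ x, HasGradientAt η (g x) x)
    (hg : ∀ x, HasFDerivAt g (H x) x) {x : Eucl n} (hx : x ∈ ball (0 : Eucl n) 1) {M B : ℝ}
    (hM : ‖g x‖ ≤ M) (hB : ‖fderiv ℝ (uncurried F) (x, η x, g x)‖ ≤ B) :
    ctrace ((fderiv ℝ (F x (η x)) (g x)).comp (H x)) - (n + 1) * (B * (1 + M)) ≤
      ctrace (fderiv ℝ (fun y => F y (η y) (g y)) x) := by
  set D := fderiv ℝ (uncurried F) (x, η x, g x)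
  have hB0 : 0 ≤ B := (norm_nonneg _).trans hB
  have hM0 : 0 ≤ M := (norm_nonneg _).trans hM
  have h1 : HasFDerivAt (fun y => ((y, η y, g y) : Eucl n × ℝ × Eucl n))
      ((ContinuousLinearMap.id ℝ _).prod
        ((InnerProductSpace.toDual ℝ (Eucl n) (g x)).prod (H x))) x :=
    (hasFDerivAt_id x).prodMk ((hη x).hasFDerivAt.prodMk (hg x))
  have h2 : HasFDerivAt (fun y => F y (η y) (g y)) (D.comp ((ContinuousLinearMap.id ℝ _).prod
        ((InnerProductSpace.toDual ℝ (Eucl n) (g x)).prod (H x)))) x :=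
    HasFDerivAt.comp (g := uncurried F) x (hasFDerivAt_structure hF hx (η x) (g x)) h1
  rw [h2.fderiv]
  have key : ∀ i : Fin (n + 1),
      ⟪((fderiv ℝ (F x (η x)) (g x)).comp (H x)) (EuclideanSpace.single i 1),
        EuclideanSpace.single i (1 : ℝ)⟫_ℝ - B * (1 + M) ≤
      ⟪(D.comp ((ContinuousLinearMap.id ℝ _).prod
        ((InnerProductSpace.toDual ℝ (Eucl n) (g x)).prod (H x)))) (EuclideanSpace.single i 1),
        EuclideanSpace.single i (1 : ℝ)⟫_ℝ := by
    intro i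
    set e : Eucl n := EuclideanSpace.single i (1 : ℝ) with he
    have hne : ‖e‖ = 1 := by simp [he]
    have hsplit : (D.comp ((ContinuousLinearMap.id ℝ _).prod
        ((InnerProductSpace.toDual ℝ (Eucl n) (g x)).prod (H x)))) e =
        D (e, ⟪g x, e⟫_ℝ, 0) + D (0, 0, H x e) := by
      rw [← map_add]; simp
    rw [hsplit, inner_add_left, ContinuousLinearMap.comp_apply,
      (fderiv_structure_snd hF hx (η x) (g x)).2]
    have h3 : |⟪D (e, ⟪g x, e⟫_ℝ, 0), e⟫_ℝ| ≤ B * (1 + M) := by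
      refine (abs_real_inner_le_norm _ _).trans ?_
      rw [hne, mul_one]
      refine (D.le_opNorm _).trans (mul_le_mul hB ?_ (norm_nonneg _) hB0)
      have h4 : |⟪g x, e⟫_ℝ| ≤ M := by
        refine (abs_real_inner_le_norm _ _).trans ?_
        rwa [hne, mul_one]
      simp only [Prod.norm_def, hne, norm_zero, Real.norm_eq_abs]
      refine max_le (by linarith) (max_le (by linarith) (by linarith))
    have := (abs_le.1 h3).1
    linarith
  have hsum := Finset.sum_le_sum fun i (_ : i ∈ Finset.univ) => key i
  rw [Finset.sum_sub_distrib] at hsum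
  simpa [ctrace] using hsum

/-- Weak comparison of a weak supersolution `w` with a strict classical subsolution `η`, where
`ψ` is a truncation of `(η - w)⁺`. -/
theorem truncation_eq_zero_of_subsolution {F : Eucl n → ℝ → Eucl n → Eucl n}
    {F₀ : Eucl n → ℝ → Eucl n → ℝ} (hF : H0 F F₀) (hell : H1 F) {z₀ : Eucl n} {r : ℝ}
    (hr : closedBall z₀ r ⊆ ball (0 : Eucl n) 1) {M B : ℝ} (hB0 : 0 < B)
    (hB : ∀ x ∈ closedBall z₀ r, ∀ z : ℝ, |z| ≤ M → ∀ p : Eucl n, ‖p‖ ≤ M →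
      ‖fderiv ℝ (uncurried F) (x, z, p)‖ ≤ B ∧ ‖F x z p‖ ≤ B ∧ |F₀ x z p| ≤ B)
    {w η ψ : Eucl n → ℝ} {g : Eucl n → Eucl n} {H : Eucl n → Eucl n →L[ℝ] Eucl n} {L C : ℝ≥0}
    (hw : LipschitzWith L w) (hLM : L ≤ M) (hwM : ∀ x ∈ closedBall z₀ r, |w x| ≤ M)
    (hη : ∀ x, HasGradientAt η (g x) x) (hg : ∀ x, HasFDerivAt g (H x) x) (hH : Continuous H)
    (hψ : LipschitzWith C ψ) (hs : tsupport ψ ⊆ ball z₀ r) (hψ0 : ∀ x, 0 ≤ ψ x)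
    (hψη : ∀ x, 0 < ψ x → ψ x = η x - w x)
    (hηM : ∀ x, 0 < ψ x → |η x| ≤ M ∧ ‖g x‖ ≤ M)
    (htr : ∀ x, 0 < ψ x → (n + 1) * (B * (1 + M)) + B * (2 * M) + B + 1 ≤
      ctrace ((fderiv ℝ (F x (η x)) (g x)).comp (H x)))
    (hweak : 0 ≤ ∫ x, weakIntegrand F F₀ w ψ x) (x : Eucl n) : ψ x = 0 := by
  have hgc : ContDiff ℝ 1 g := contDiff_one_of_hasFDerivAt hg hH
  have hηc : ContDiff ℝ 1 η := contDiff_one_of_hasGradientAt hη hgc.continuous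
  have hG : ContDiffOn ℝ 1 (fun y => F y (η y) (g y)) (ball (0 : Eucl n) 1) :=
    (contDiffOn_uncurried hF).comp (contDiff_id.prodMk (hηc.prodMk hgc)).contDiffOn
      fun y hy => ⟨hy, trivial, trivial⟩
  obtain ⟨hI2, hJ⟩ := integral_inner_gradient_add_eq_zero isOpen_ball hr hG hψ hs
  have hI1 := integrable_weakIntegrand hF hr hw hψ hs
  have hψc : HasCompactSupport ψ := (isCompact_closedBall z₀ r).of_isClosed_subset
    (isClosed_tsupport ψ) (hs.trans ball_subset_closedBall)
  have hIψ : Integrable ψ := hψ.continuous.integrable_of_hasCompactSupport hψc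
  have hpt : ∀ᵐ x, weakIntegrand F F₀ w ψ x - (⟪F x (η x) (g x), gradient ψ x⟫_ℝ +
      ctrace (fderiv ℝ (fun y => F y (η y) (g y)) x) * ψ x) ≤ - ψ x := by
    filter_upwards [hw.ae_differentiableAt] with x hwx
    rcases (hψ0 x).eq_or_lt with h0 | hpos
    · have hmin : IsLocalMin ψ x := .of_forall fun y => by rw [← h0]; exact hψ0 y
      have : gradient ψ x = 0 := by simp [gradient, hmin.fderiv_eq_zero]
      simp [weakIntegrand, this, ← h0]
    · have hxs : x ∈ tsupport ψ := subset_tsupport _ (Function.mem_support.2 hpos.ne')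
      have hxr : x ∈ closedBall z₀ r := ball_subset_closedBall (hs hxs)
      have hx1 := hr hxr
      obtain ⟨hη1, hη2⟩ := hηM x hpos
      have hgw : ‖gradient w x‖ ≤ M := (norm_gradient_le_of_lipschitzWith hw x).trans hLM
      have hgrad : gradient ψ x = g x - gradient w x := by
        have h1 : ψ =ᶠ[𝓝 x] fun y => η y - w y := by
          filter_upwards [(isOpen_lt continuous_const hψ.continuous).mem_nhds hpos] with y hy
          exact hψη y hy
        rw [h1.gradient_eq]
        have h2 := (hη x).hasFDerivAt.sub hwx.hasGradientAt.hasFDerivAt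
        rw [← map_sub] at h2
        exact (hasGradientAt_iff_hasFDerivAt.2 h2).gradient
      have hdiv := le_ctrace_fderiv_structure hF hη hg hx1 hη2 (hB x hxr _ hη1 _ hη2).1
      have hmono := structure_monotone hF hell hx1 (η x) (g x) (gradient w x)
      have hval := structure_lipschitz_value hF (p := gradient w x) hx1
        (fun z hz => (hB x hxr z hz _ hgw).1) (hwM x hxr) hη1
      have hF0 := (hB x hxr _ (hwM x hxr) _ hgw).2.2
      have hwη : |w x - η x| = ψ x := by
        rw [abs_sub_comm, ← hψη x hpos, abs_of_pos hpos]
      rw [hwη] at hval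
      have h5 : ⟪F x (w x) (gradient w x) - F x (η x) (gradient w x), g x - gradient w x⟫_ℝ ≤
          B * ψ x * (2 * M) := by
        refine (real_inner_le_norm _ _).trans (mul_le_mul hval ?_ (norm_nonneg _) (by positivity))
        exact (norm_sub_le _ _).trans (by linarith)
      have h6 : F₀ x (w x) (gradient w x) * ψ x ≤ B * ψ x :=
        mul_le_mul_of_nonneg_right ((le_abs_self _).trans hF0) hpos.le
      have h7 := mul_le_mul_of_nonneg_right (htr x hpos) hpos.le
      have h8 := mul_le_mul_of_nonneg_right hdiv hpos.le
      rw [inner_sub_left] at hmono h5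
      simp only [weakIntegrand, hgrad]
      nlinarith
  have h_integral := integral_mono_ae (hI1.sub hI2) hIψ.neg hpt
  simp only [Pi.sub_apply, Pi.neg_apply] at h_integral
  rw [integral_sub hI1 hI2, hJ, integral_neg] at h_integral
  have hzero : ∫ x, ψ x = 0 := le_antisymm (by linarith) (integral_nonneg hψ0)
  have hae := (integral_eq_zero_iff_of_nonneg hψ0 hIψ).1 hzero
  exact congrFun ((hψ.continuous.ae_eq_iff_eq volume continuous_const).1 hae) x

/-- A function which is Lipschitz on a set containing the closure of `Ω` and vanishes on the
frontier of `Ω` remains Lipschitz when extended by zero. -/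
theorem LipschitzOnWith.indicator_of_frontier {f : Eucl n → ℝ} {C : ℝ≥0} {Ω S : Set (Eucl n)}
    (hf : LipschitzOnWith C f S) (hS : closure Ω ⊆ S) (h0 : ∀ x ∈ frontier Ω, f x = 0) :
    LipschitzWith C (Ω.indicator f) := by
  have key : ∀ x ∈ Ω, ∀ y ∉ Ω, dist (f x) 0 ≤ C * dist x y := by
    intro x hx y hy
    obtain ⟨z, hz, hzf⟩ : ∃ z ∈ segment ℝ x y, z ∈ frontier Ω := by
      by_contra! hn
      have hxi : x ∈ interior Ω := by
        by_contra h
        exact hn x (left_mem_segment ℝ x y) ⟨subset_closure hx, h⟩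
      have hyc : y ∈ (closure Ω)ᶜ := fun h =>
        hn y (right_mem_segment ℝ x y) ⟨h, fun h' => hy (interior_subset h')⟩
      obtain ⟨z, -, hz1, hz2⟩ := (convex_segment x y).isPreconnected _ _ isOpen_interior
        isClosed_closure.isOpen_compl
        (fun z hz => by
          by_contra h
          simp only [Set.mem_union, Set.mem_compl_iff, not_or, not_not] at h
          exact hn z hz ⟨h.2, h.1⟩)
        ⟨x, left_mem_segment ℝ x y, hxi⟩ ⟨y, right_mem_segment ℝ x y, hyc⟩
      exact hz2 (interior_subset_closure hz1)
    rw [← h0 z hzf]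
    refine (hf.dist_le_mul x (hS (subset_closure hx)) z
      (hS (frontier_subset_closure hzf))).trans ?_
    gcongr
    have := dist_add_dist_of_mem_segment hz
    linarith [dist_nonneg (x := z) (y := y)]
  refine LipschitzWith.of_dist_le_mul fun x y => ?_
  by_cases hx : x ∈ Ω <;> by_cases hy : y ∈ Ω
  · simpa [hx, hy] using hf.dist_le_mul x (hS (subset_closure hx)) y (hS (subset_closure hy))
  · simpa [hx, hy] using key x hx y hy
  · have := key y hy x hx
    rw [dist_comm, dist_comm y] at this
    simpa [hx, hy] using this
  · simp only [Set.indicator_of_notMem, hx, hy, not_false_eq_true, dist_self]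
    positivity

theorem le_ctrace_comp_of_rankOne_sub {A P : Eucl n →L[ℝ] Eucl n} {v : Eucl n} {a lam B T : ℝ}
    (hlam : 0 < lam) (hB : 0 ≤ B) (hT : 0 ≤ T) (ha : 0 ≤ a) (hA : lam * ‖v‖ ^ 2 ≤ ⟪A v, v⟫_ℝ)
    (hAB : ‖A‖ ≤ B) (h : (T + (n + 1) * B) / lam * (1 + ‖P‖) ≤ a * ‖v‖ ^ 2) :
    T ≤ ctrace (A.comp (a • (innerSL ℝ v).smulRight v - P)) := by
  have h1 : ctrace (A.comp (a • (innerSL ℝ v).smulRight v - P)) =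
      a * ⟪A v, v⟫_ℝ - ctrace (A.comp P) := by
    rw [← ctrace_comp_rankOne]
    simp only [ctrace, ContinuousLinearMap.comp_sub, ContinuousLinearMap.comp_smul,
      _root_.sub_apply, inner_sub_left, Finset.sum_sub_distrib,
      _root_.smul_apply, inner_smul_left, Finset.mul_sum]
    simp
  have h2 : ctrace (A.comp P) ≤ (n + 1) * (B * ‖P‖) := by
    refine (le_abs_self _).trans ((abs_ctrace_le _).trans ?_)
    gcongr
    exact (A.opNorm_comp_le P).trans (by gcongr)
  rw [div_mul_eq_mul_div, div_le_iff₀ hlam] at h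
  have h3 := mul_le_mul_of_nonneg_left hA ha
  rw [h1]
  have h4 : 0 ≤ T * ‖P‖ := by positivity
  have h5 : 0 ≤ (n + 1) * B := by positivity
  nlinarith

/-- Comparison principle: there is a constant `K` such that a classical function `η` whose
Hessian is a sufficiently large rank one matrix minus a matrix `P` lies below every weak
supersolution `w` with `η ≤ w` on the frontier. -/
theorem exists_comparison_constant {F : Eucl n → ℝ → Eucl n → Eucl n}
    {F₀ : Eucl n → ℝ → Eucl n → ℝ} (hF : H0 F F₀) (hell : H1 F) {z₀ : Eucl n} {r : ℝ}
    (hr : closedBall z₀ r ⊆ ball (0 : Eucl n) 1) {M : ℝ} (hM : 0 < M) :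
    ∃ K : ℝ, 0 < K ∧ ∀ (w η : Eucl n → ℝ) (g : Eucl n → Eucl n) (H : Eucl n → Eucl n →L[ℝ] Eucl n)
      (L : ℝ≥0) (Ω : Set (Eucl n)),
      LipschitzWith L w → L ≤ M → (∀ x ∈ closedBall z₀ r, |w x| ≤ M) →
      (∀ x, HasGradientAt η (g x) x) → (∀ x, HasFDerivAt g (H x) x) → Continuous H →
      IsOpen Ω → Ω ⊆ ball z₀ r → (∀ x ∈ Ω, |η x| + 1 ≤ M ∧ ‖g x‖ ≤ M) →
      (∀ x ∈ frontier Ω, η x ≤ w x) →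
      (∀ x ∈ Ω, w x < η x → ∃ (a : ℝ) (v : Eucl n) (P : Eucl n →L[ℝ] Eucl n), 0 ≤ a ∧
        H x = a • (innerSL ℝ v).smulRight v - P ∧ K * (1 + ‖P‖) ≤ a * ‖v‖ ^ 2) →
      (∀ (ψ : Eucl n → ℝ) (C : ℝ≥0), LipschitzWith C ψ → tsupport ψ ⊆ Ω → (∀ x, 0 ≤ ψ x) →
        (∀ x, ψ x ≤ max (η x - w x) 0) → 0 ≤ ∫ x, weakIntegrand F F₀ w ψ x) →
      ∀ x ∈ Ω, η x ≤ w x := by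
  obtain ⟨B, hB0, hB⟩ := exists_structure_bound hF hr M
  obtain ⟨lam, hlam, hlamF⟩ := hell M hM
  set T : ℝ := (n + 1) * (B * (1 + M)) + B * (2 * M) + B + 1
  have hT : 0 < T := by positivity
  refine ⟨(T + (n + 1) * B) / lam, by positivity, ?_⟩
  intro w η g H L Ω hw hLM hwM hη hg hH hΩ hΩr hηM hfr h2nd hweak x hx
  by_contra! hlt
  set ε : ℝ := min 1 ((η x - w x) / 2)
  have hε : 0 < ε := lt_min one_pos (by linarith)
  have hε1 : ε ≤ 1 := min_le_left _ _
  have hεx : ε ≤ (η x - w x) / 2 := min_le_right _ _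
  set f : Eucl n → ℝ := fun y => max (η y - ε - w y) 0
  set ψ : Eucl n → ℝ := Ω.indicator f
  have hgc : ContDiff ℝ 1 g := contDiff_one_of_hasFDerivAt hg hH
  have hηc : ContDiff ℝ 1 η := contDiff_one_of_hasGradientAt hη hgc.continuous
  have hcl : closure Ω ⊆ closedBall z₀ r := (closure_mono hΩr).trans closure_ball_subset_closedBall
  obtain ⟨Lη, hLη⟩ := (hηc.locallyLipschitz.locallyLipschitzOn
    (s := closedBall z₀ r)).exists_lipschitzOnWith_of_compact (isCompact_closedBall z₀ r)
  have hfL : LipschitzOnWith (Lη + L) f (closedBall z₀ r) := by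
    have h1 := hLη.sub (hw.lipschitzOnWith (s := closedBall z₀ r))
    refine LipschitzOnWith.of_dist_le_mul fun y hy z hz => ?_
    have h2 := h1.dist_le_mul y hy z hz
    rw [Real.dist_eq] at h2 ⊢
    refine (abs_max_sub_max_le_abs _ _ _).trans ?_
    have e : η y - ε - w y - (η z - ε - w z) = η y - w y - (η z - w z) := by ring
    rw [e]
    exact h2
  have hψL : LipschitzWith (Lη + L) ψ := LipschitzOnWith.indicator_of_frontier hfL hcl
    fun y hy => max_eq_right (by linarith [hfr y hy])
  have hψ0 : ∀ y, 0 ≤ ψ y := fun y => Set.indicator_nonneg (fun _ _ => le_max_right _ _) y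
  have hψpos : ∀ y, 0 < ψ y → y ∈ Ω ∧ ψ y = η y - ε - w y := by
    intro y hy
    have hyΩ : y ∈ Ω := by
      by_contra hn
      simp [ψ, hn] at hy
    refine ⟨hyΩ, ?_⟩
    have h1 : ψ y = max (η y - ε - w y) 0 := Set.indicator_of_mem hyΩ _
    rw [h1] at hy ⊢
    exact max_eq_left ((lt_max_iff.1 hy).resolve_right (lt_irrefl _)).le
  have hψs : tsupport ψ ⊆ Ω := by
    have hc : IsClosed (closure Ω ∩ {y | ε ≤ η y - w y}) :=
      isClosed_closure.inter (isClosed_le continuous_const (hηc.continuous.sub hw.continuous))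
    have hsub : tsupport ψ ⊆ closure Ω ∩ {y | ε ≤ η y - w y} := by
      refine closure_minimal (fun y hy => ?_) hc
      have hp : 0 < ψ y := (hψ0 y).lt_of_ne' hy
      obtain ⟨h1, h2⟩ := hψpos y hp
      exact ⟨subset_closure h1, show ε ≤ η y - w y by linarith⟩
    intro y hy
    by_contra hn
    have : y ∈ frontier Ω := ⟨(hsub hy).1, by rwa [hΩ.interior_eq]⟩
    have h1 := hfr y this
    have h2 : ε ≤ η y - w y := (hsub hy).2
    linarith
  have hweakψ := hweak ψ _ hψL hψs hψ0 fun y => by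
    rcases (hψ0 y).eq_or_lt with h | h
    · rw [← h]; exact le_max_right _ _
    · rw [(hψpos y h).2]; exact (by linarith : _ ≤ η y - w y).trans (le_max_left _ _)
  have hηε : ∀ y, HasGradientAt (fun y => η y - ε) (g y) y := fun y =>
    ((hη y).hasFDerivAt.sub_const ε : HasFDerivAt _ _ _)
  have hbd : ∀ y, 0 < ψ y → |η y - ε| ≤ M ∧ ‖g y‖ ≤ M := fun y hy => by
    have := hηM y (hψpos y hy).1
    refine ⟨?_, this.2⟩
    have h1 := abs_sub (η y) ε
    rw [abs_of_pos hε] at h1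
    linarith [this.1]
  have hzero := truncation_eq_zero_of_subsolution hF hell hr hB0 hB hw hLM hwM hηε hg hH hψL
    (hψs.trans hΩr) hψ0 (fun y hy => (hψpos y hy).2) hbd
    (fun y hy => by
      obtain ⟨hyΩ, hyeq⟩ := hψpos y hy
      have hyr := ball_subset_closedBall (hΩr hyΩ)
      obtain ⟨hb1, hb2⟩ := hbd y hy
      obtain ⟨a, v, P, ha, hHy, hK⟩ := h2nd y hyΩ (by linarith)
      rw [hHy]
      refine le_ctrace_comp_of_rankOne_sub hlam hB0.le hT.le ha
        (hlamF y (hr hyr) _ hb1 _ hb2 v) ?_ hK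
      refine ContinuousLinearMap.opNorm_le_bound _ hB0.le fun ξ => ?_
      rw [(fderiv_structure_snd hF (hr hyr) _ _).2]
      refine (ContinuousLinearMap.le_opNorm _ _).trans ?_
      refine mul_le_mul (hB y hyr _ hb1 _ hb2).1 ?_ (norm_nonneg _) hB0.le
      simp) hweakψ x
  have : ψ x = max (η x - ε - w x) 0 := Set.indicator_of_mem hx _
  rw [hzero, max_eq_left (by linarith)] at this
  linarith

/-- The shear `v ↦ v + ⟪ν, v⟫ b`. -/
def shear (ν b : Eucl n) : Eucl n →L[ℝ] Eucl n :=
  ContinuousLinearMap.id ℝ (Eucl n) + (innerSL ℝ ν).smulRight b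

/-- The symmetric operator `TᵀT` of the shear `T`. -/
def shearForm (ν b : Eucl n) : Eucl n →L[ℝ] Eucl n :=
  (ContinuousLinearMap.adjoint (shear ν b)).comp (shear ν b)

theorem shear_apply (ν b v : Eucl n) : shear ν b v = v + ⟪ν, v⟫_ℝ • b := by
  simp [shear]

theorem inner_shearForm (ν b v w : Eucl n) :
    ⟪shearForm ν b v, w⟫_ℝ = ⟪shear ν b v, shear ν b w⟫_ℝ := by
  simp [shearForm, ContinuousLinearMap.adjoint_inner_left]

theorem inner_shear {ν b : Eucl n} (hb : ⟪ν, b⟫_ℝ = 0) (v : Eucl n) :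
    ⟪ν, shear ν b v⟫_ℝ = ⟪ν, v⟫_ℝ := by
  simp [shear_apply, inner_add_right, inner_smul_right, hb]

theorem norm_shear_le {ν b : Eucl n} (hν : ‖ν‖ = 1) (v : Eucl n) :
    ‖shear ν b v‖ ≤ (1 + ‖b‖) * ‖v‖ := by
  rw [shear_apply]
  refine (norm_add_le _ _).trans ?_
  rw [norm_smul, Real.norm_eq_abs]
  have h := abs_real_inner_le_norm ν v
  rw [hν, one_mul] at h
  nlinarith [norm_nonneg b]

theorem norm_le_norm_shear {ν b : Eucl n} (hν : ‖ν‖ = 1) (hb : ⟪ν, b⟫_ℝ = 0) (v : Eucl n) :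
    ‖v‖ ≤ (1 + ‖b‖) * ‖shear ν b v‖ := by
  have h := norm_shear_le (b := -b) hν (shear ν b v)
  rw [shear_apply ν (-b), inner_shear hb, norm_neg] at h
  simpa [shear_apply] using h

theorem norm_shearForm_apply_le {ν b : Eucl n} (hν : ‖ν‖ = 1) (v : Eucl n) :
    ‖shearForm ν b v‖ ≤ (1 + ‖b‖) * ‖shear ν b v‖ := by
  have h1 : ‖shear ν b‖ ≤ 1 + ‖b‖ :=
    ContinuousLinearMap.opNorm_le_bound _ (by positivity) (norm_shear_le hν)
  rw [shearForm, ContinuousLinearMap.comp_apply]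
  refine (ContinuousLinearMap.le_opNorm _ _).trans ?_
  rw [LinearIsometryEquiv.norm_map]
  gcongr

theorem norm_shearForm_le {ν b : Eucl n} (hν : ‖ν‖ = 1) :
    ‖shearForm ν b‖ ≤ (1 + ‖b‖) ^ 2 := by
  refine ContinuousLinearMap.opNorm_le_bound _ (by positivity) fun v => ?_
  refine (norm_shearForm_apply_le hν v).trans ?_
  rw [pow_two, mul_assoc]
  gcongr
  exact norm_shear_le hν v

theorem norm_le_norm_shearForm_apply {ν b : Eucl n} (hν : ‖ν‖ = 1) (hb : ⟪ν, b⟫_ℝ = 0)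
    (v : Eucl n) : ‖v‖ ≤ (1 + ‖b‖) ^ 2 * ‖shearForm ν b v‖ := by
  rcases (norm_nonneg v).eq_or_lt with h | h
  · rw [← h]; positivity
  have h1 := norm_le_norm_shear hν hb v
  have h2 : ‖shear ν b v‖ ^ 2 ≤ ‖shearForm ν b v‖ * ‖v‖ := by
    rw [← real_inner_self_eq_norm_sq, ← inner_shearForm]
    exact real_inner_le_norm _ _
  have h3 : ‖v‖ ^ 2 ≤ (1 + ‖b‖) ^ 2 * ‖shear ν b v‖ ^ 2 := by
    rw [← mul_pow]; gcongr
  have h4 : 0 ≤ (1 + ‖b‖) ^ 2 := by positivity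
  have h5 := mul_le_mul_of_nonneg_left h2 h4
  refine le_of_mul_le_mul_right ?_ h
  nlinarith

theorem hasGradientAt_quadratic (P : Eucl n →L[ℝ] Eucl n)
    (hP : ∀ v w, ⟪P v, w⟫_ℝ = ⟪P w, v⟫_ℝ) (x₁ x : Eucl n) :
    HasGradientAt (fun x => ⟪P (x - x₁), x - x₁⟫_ℝ) ((2 : ℝ) • P (x - x₁)) x := by
  rw [hasGradientAt_iff_hasFDerivAt]
  have h0 : HasFDerivAt (fun x : Eucl n => x - x₁) (ContinuousLinearMap.id ℝ _) x :=
    (hasFDerivAt_id x).sub_const x₁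
  have h1 := (P.hasFDerivAt.comp x h0).inner ℝ h0
  convert! h1 using 1
  ext v
  simp [hP v, two_mul, fderivInnerCLM_apply, inner_sub_left]

theorem hasGradientAt_expBarrier (P : Eucl n →L[ℝ] Eucl n)
    (hP : ∀ v w, ⟪P v, w⟫_ℝ = ⟪P w, v⟫_ℝ) (x₁ ν : Eucl n)
    (m A β c : ℝ) (z₀ x : Eucl n) :
    HasGradientAt (fun x => m * ⟪ν, x - z₀⟫_ℝ + A * (Real.exp (-β * ⟪P (x - x₁), x - x₁⟫_ℝ) - c))
      (m • ν - (2 * β * (A * Real.exp (-β * ⟪P (x - x₁), x - x₁⟫_ℝ))) • P (x - x₁)) x := by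
  have h1 := (hasGradientAt_iff_hasFDerivAt.1 (hasGradientAt_quadratic P hP x₁ x))
  have h2 := (((h1.const_mul (-β)).exp.sub_const c).const_mul A)
  have h3 : HasFDerivAt (fun x : Eucl n => ⟪ν, x - z₀⟫_ℝ) (innerSL ℝ ν) x :=
    (innerSL ℝ ν).hasFDerivAt.comp x ((hasFDerivAt_id x).sub_const z₀)
  rw [hasGradientAt_iff_hasFDerivAt]
  convert! (h3.const_mul m).add h2 using 1
  ext v
  simp [inner_sub_left]
  ring

theorem hasFDerivAt_expBarrier_gradient (P : Eucl n →L[ℝ] Eucl n)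
    (hP : ∀ v w, ⟪P v, w⟫_ℝ = ⟪P w, v⟫_ℝ) (x₁ ν : Eucl n)
    (m A β : ℝ) (x : Eucl n) :
    HasFDerivAt (fun x =>
        m • ν - (2 * β * (A * Real.exp (-β * ⟪P (x - x₁), x - x₁⟫_ℝ))) • P (x - x₁))
      ((4 * β ^ 2 * (A * Real.exp (-β * ⟪P (x - x₁), x - x₁⟫_ℝ))) •
          (innerSL ℝ (P (x - x₁))).smulRight (P (x - x₁)) -
        (2 * β * (A * Real.exp (-β * ⟪P (x - x₁), x - x₁⟫_ℝ))) • P) x := by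
  have h1 := (hasGradientAt_iff_hasFDerivAt.1 (hasGradientAt_quadratic P hP x₁ x))
  have h2 := (((h1.const_mul (-β)).exp.const_mul A).const_mul (2 * β))
  have h0 : HasFDerivAt (fun x : Eucl n => x - x₁) (ContinuousLinearMap.id ℝ _) x :=
    (hasFDerivAt_id x).sub_const x₁
  have h3 := (h2.smul (P.hasFDerivAt.comp x h0)).const_sub (m • ν)
  convert! h3 using 1
  ext1 v
  simp [smul_smul]
  module

/-- `w` is a weak supersolution in `U`, tested against Lipschitz functions. -/
def WeakSupersolution (F : Eucl n → ℝ → Eucl n → Eucl n) (F₀ : Eucl n → ℝ → Eucl n → ℝ)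
    (w : Eucl n → ℝ) (U : Set (Eucl n)) : Prop :=
  ∀ (ψ : Eucl n → ℝ) (C : ℝ≥0), LipschitzWith C ψ → tsupport ψ ⊆ U → (∀ x, 0 ≤ ψ x) →
    0 ≤ ∫ x, weakIntegrand F F₀ w ψ x

/-- Lower bound by an exponential barrier on a sheared ball touching the thin space. -/
theorem exists_shear_barrier {F : Eucl n → ℝ → Eucl n → Eucl n}
    {F₀ : Eucl n → ℝ → Eucl n → ℝ} (hF : H0 F F₀) (hell : H1 F) {z₀ : Eucl n} {r : ℝ}
    (hr : closedBall z₀ r ⊆ ball (0 : Eucl n) 1) {M : ℝ} (hM : 0 < M) :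
    ∃ K : ℝ, 0 < K ∧ ∀ (u : Eucl n → ℝ) (L : ℝ≥0) (ν b x₁ : Eucl n) (m A β R h : ℝ),
      LipschitzWith L u → L ≤ M → (∀ x ∈ closedBall z₀ r, |u x| ≤ M) → ‖ν‖ = 1 → ⟪ν, b⟫_ℝ = 0 →
      WeakSupersolution F F₀ u (ball z₀ r ∩ {x | 0 < ⟪ν, x - z₀⟫_ℝ}) →
      h = ⟪ν, x₁ - z₀⟫_ℝ → 0 < h → 0 < A → 0 < β → 0 < R →
      (1 + ‖b‖) * h + ‖x₁ - z₀‖ < r →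
      (∀ x, ‖x - x₁‖ ≤ (1 + ‖b‖) * h → 0 ≤ ⟪ν, x - z₀⟫_ℝ → m * ⟪ν, x - z₀⟫_ℝ ≤ u x) →
      (∀ x, ‖x - x₁‖ < R → 0 ≤ ⟪ν, x - z₀⟫_ℝ → m * ⟪ν, x - z₀⟫_ℝ + A ≤ u x) →
      |m| * r + A + 1 ≤ M → |m| + 2 * β * A * ((1 + ‖b‖) * h) ≤ M →
      K * (1 + ‖b‖) ^ 6 ≤ β * R ^ 2 →
      K * (1 + ‖b‖) ^ 4 ≤ 2 * β ^ 2 * (A * Real.exp (-β * h ^ 2)) * R ^ 2 →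
      ∀ x, ‖shear ν b (x - x₁)‖ ^ 2 < h ^ 2 →
        m * ⟪ν, x - z₀⟫_ℝ +
          A * (Real.exp (-β * ‖shear ν b (x - x₁)‖ ^ 2) - Real.exp (-β * h ^ 2)) ≤ u x := by
  obtain ⟨K, hK, hcomp⟩ := exists_comparison_constant hF hell hr hM
  refine ⟨K, hK, ?_⟩
  intro u L ν b x₁ m A β R h hu hLM huM hν hb hsup hh hh0 hA hβ hR hrad hfr hbump hM1 hM2 hK1 hK2
  set P := shearForm ν b
  have hP : ∀ v w, ⟪P v, w⟫_ℝ = ⟪P w, v⟫_ℝ := fun v w => by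
    rw [inner_shearForm, inner_shearForm, real_inner_comm]
  have hφ : ∀ x, ⟪P (x - x₁), x - x₁⟫_ℝ = ‖shear ν b (x - x₁)‖ ^ 2 := fun x => by
    rw [inner_shearForm, real_inner_self_eq_norm_sq]
  have hφc : Continuous fun x => ‖shear ν b (x - x₁)‖ ^ 2 := by fun_prop
  set Ω : Set (Eucl n) := {x | ‖shear ν b (x - x₁)‖ ^ 2 < h ^ 2}
  have hgeo : ∀ x, ‖shear ν b (x - x₁)‖ ^ 2 ≤ h ^ 2 →
      0 ≤ ⟪ν, x - z₀⟫_ℝ ∧ ‖x - x₁‖ ≤ (1 + ‖b‖) * h ∧ ‖x - z₀‖ < r := by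
    intro x hx
    have h1 : ‖shear ν b (x - x₁)‖ ≤ h := (sq_le_sq₀ (norm_nonneg _) hh0.le).1 hx
    have h2 : |⟪ν, x - x₁⟫_ℝ| ≤ h := by
      rw [← inner_shear hb]
      refine (abs_real_inner_le_norm _ _).trans ?_
      rwa [hν, one_mul]
    have h3 : ⟪ν, x - z₀⟫_ℝ = ⟪ν, x - x₁⟫_ℝ + h := by
      rw [hh, ← inner_add_right]; congr 1; abel
    have h4 : ‖x - x₁‖ ≤ (1 + ‖b‖) * h := (norm_le_norm_shear hν hb _).trans (by gcongr)
    refine ⟨by rw [h3]; linarith [neg_abs_le (⟪ν, x - x₁⟫_ℝ)], h4, ?_⟩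
    have := norm_sub_le_norm_sub_add_norm_sub x x₁ z₀
    linarith
  have hΩpos : ∀ x ∈ Ω, 0 < ⟪ν, x - z₀⟫_ℝ := by
    intro x hx
    have h1 : ‖shear ν b (x - x₁)‖ < h := (sq_lt_sq₀ (norm_nonneg _) hh0.le).1 hx
    have h2 : |⟪ν, x - x₁⟫_ℝ| < h := by
      rw [← inner_shear hb]
      refine (abs_real_inner_le_norm _ _).trans_lt ?_
      rwa [hν, one_mul]
    have h3 : ⟪ν, x - z₀⟫_ℝ = ⟪ν, x - x₁⟫_ℝ + h := by
      rw [hh, ← inner_add_right]; congr 1; abel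
    rw [h3]; linarith [neg_abs_le (⟪ν, x - x₁⟫_ℝ)]
  have hexp : ∀ x, Real.exp (-β * ‖shear ν b (x - x₁)‖ ^ 2) ≤ 1 := fun x => by
    rw [Real.exp_le_one_iff]; nlinarith [sq_nonneg ‖shear ν b (x - x₁)‖]
  have hexph : Real.exp (-β * h ^ 2) ≤ 1 := by
    rw [Real.exp_le_one_iff]; nlinarith [sq_nonneg h]
  have hexp' : ∀ x ∈ Ω, Real.exp (-β * h ^ 2) ≤ Real.exp (-β * ‖shear ν b (x - x₁)‖ ^ 2) :=
    fun x hx => Real.exp_le_exp.2 (by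
      have : ‖shear ν b (x - x₁)‖ ^ 2 < h ^ 2 := hx
      nlinarith)
  have hpr : ∀ x ∈ Ω, |⟪ν, x - z₀⟫_ℝ| ≤ r := fun x hx => by
    refine (abs_real_inner_le_norm _ _).trans ?_
    rw [hν, one_mul]
    exact (hgeo x (le_of_lt hx)).2.2.le
  have main := hcomp u _ _ _ L Ω hu hLM huM
    (hasGradientAt_expBarrier P hP x₁ ν m A β (Real.exp (-β * h ^ 2)) z₀)
    (hasFDerivAt_expBarrier_gradient P hP x₁ ν m A β)
    (by fun_prop) (isOpen_lt hφc continuous_const)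
    (fun x hx => mem_ball_iff_norm.2 (hgeo x (le_of_lt hx)).2.2) ?_ ?_ ?_ ?_
  · intro x hx
    have := main x hx
    simpa only [hφ] using this
  · intro x hx
    rw [hφ]
    have e1 := hexp x
    have e2 := hexp' x hx
    have e3 := Real.exp_pos (-β * h ^ 2)
    constructor
    · have h1 : |m * ⟪ν, x - z₀⟫_ℝ| ≤ |m| * r := by
        rw [abs_mul]; gcongr; exact hpr x hx
      have h2 : |A * (Real.exp (-β * ‖shear ν b (x - x₁)‖ ^ 2) - Real.exp (-β * h ^ 2))| ≤ A := by
        rw [abs_of_nonneg (mul_nonneg hA.le (by linarith))]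
        nlinarith
      linarith [abs_add_le (m * ⟪ν, x - z₀⟫_ℝ)
        (A * (Real.exp (-β * ‖shear ν b (x - x₁)‖ ^ 2) - Real.exp (-β * h ^ 2)))]
    · refine (norm_sub_le _ _).trans (le_trans ?_ hM2)
      rw [norm_smul, norm_smul, hν, mul_one, Real.norm_eq_abs, Real.norm_eq_abs,
        abs_of_pos (mul_pos (by positivity) (mul_pos hA (Real.exp_pos _))), ← mul_assoc]
      have h1 : ‖shear ν b (x - x₁)‖ ≤ h := ((sq_lt_sq₀ (norm_nonneg _) hh0.le).1 hx).le
      have h2 : ‖P (x - x₁)‖ ≤ (1 + ‖b‖) * h :=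
        (norm_shearForm_apply_le hν _).trans (by gcongr)
      have h3 : 2 * β * A * Real.exp (-β * ‖shear ν b (x - x₁)‖ ^ 2) ≤ 2 * β * A :=
        mul_le_of_le_one_right (by positivity) e1
      exact add_le_add_right (mul_le_mul h3 h2 (norm_nonneg _) (by positivity)) _
  · intro x hx
    have h1 : ‖shear ν b (x - x₁)‖ ^ 2 = h ^ 2 := frontier_lt_subset_eq hφc continuous_const hx
    rw [hφ, h1, sub_self, mul_zero, add_zero]
    exact hfr x (hgeo x h1.le).2.1 (hgeo x h1.le).1
  · intro x hx hlt
    rw [hφ] at hlt ⊢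
    set E := A * Real.exp (-β * ‖shear ν b (x - x₁)‖ ^ 2)
    have hE : A * Real.exp (-β * h ^ 2) ≤ E := by
      exact mul_le_mul_of_nonneg_left (hexp' x hx) hA.le
    have hE0 : 0 < E := by positivity
    have hxR : R ≤ ‖x - x₁‖ := by
      by_contra! hn
      have h1 := hbump x hn (hΩpos x hx).le
      have h2 := Real.exp_pos (-β * h ^ 2)
      have h3 := hexp x
      nlinarith
    refine ⟨4 * β ^ 2 * E, P (x - x₁), (2 * β * E) • P, by positivity, rfl, ?_⟩
    rw [norm_smul, Real.norm_eq_abs, abs_of_pos (by positivity)]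
    set τ := 1 + ‖b‖
    have hτ : 0 < τ := by positivity
    have h1 : R ≤ τ ^ 2 * ‖P (x - x₁)‖ := hxR.trans (norm_le_norm_shearForm_apply hν hb _)
    have h2 : R ^ 2 ≤ τ ^ 4 * ‖P (x - x₁)‖ ^ 2 := by
      calc R ^ 2 ≤ (τ ^ 2 * ‖P (x - x₁)‖) ^ 2 := by gcongr
        _ = _ := by ring
    have h3 : ‖P‖ ≤ τ ^ 2 := norm_shearForm_le hν
    refine le_of_mul_le_mul_left ?_ (pow_pos hτ 4)
    have h4 : K * τ ^ 4 ≤ 2 * β ^ 2 * E * R ^ 2 := hK2.trans (by gcongr)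
    have h5 : 2 * β * E * (K * τ ^ 6) ≤ 2 * β * E * (β * R ^ 2) := by gcongr
    calc τ ^ 4 * (K * (1 + 2 * β * E * ‖P‖))
        ≤ τ ^ 4 * (K * (1 + 2 * β * E * τ ^ 2)) := by gcongr
      _ = K * τ ^ 4 + 2 * β * E * (K * τ ^ 6) := by ring
      _ ≤ 4 * β ^ 2 * E * R ^ 2 := by linarith
      _ ≤ 4 * β ^ 2 * E * (τ ^ 4 * ‖P (x - x₁)‖ ^ 2) := by gcongr
      _ = _ := by ring
  · intro ψ C hψ hψs hψ0 _
    refine hsup ψ C hψ (hψs.trans fun x hx => ?_) hψ0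
    exact ⟨mem_ball_iff_norm.2 (hgeo x (le_of_lt hx)).2.2, hΩpos x hx⟩

/-- The shear centred at `x₁` adapted to the point `x`. -/
theorem exists_shear_vector {ν z₀ x₁ x : Eucl n} (hν : ‖ν‖ = 1) (h0 : 0 < ⟪ν, x₁ - z₀⟫_ℝ) :
    ∃ b : Eucl n, ⟪ν, b⟫_ℝ = 0 ∧ ‖b‖ * ⟪ν, x₁ - z₀⟫_ℝ ≤ ‖x₁ - z₀‖ + ‖x - z₀‖ ∧
      ‖shear ν b (x - x₁)‖ ^ 2 =
        ⟪ν, x - z₀⟫_ℝ ^ 2 * ‖b‖ ^ 2 + (⟪ν, x₁ - z₀⟫_ℝ - ⟪ν, x - z₀⟫_ℝ) ^ 2 := by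
  set h := ⟪ν, x₁ - z₀⟫_ℝ
  set s := ⟪ν, x - z₀⟫_ℝ
  have hνν : ⟪ν, ν⟫_ℝ = 1 := by rw [real_inner_self_eq_norm_sq, hν, one_pow]
  set q : Eucl n := (x - x₁) - ⟪ν, x - x₁⟫_ℝ • ν
  have hs : ⟪ν, x - x₁⟫_ℝ = s - h := by
    rw [← inner_sub_right]; congr 1; abel
  have hq : ⟪ν, q⟫_ℝ = 0 := by
    simp [q, inner_sub_right, inner_smul_right, hν]
  have hqn : ‖q‖ ≤ ‖x - x₁‖ := by
    have : x - x₁ = q + ⟪ν, x - x₁⟫_ℝ • ν := by simp [q]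
    have h2 : ‖x - x₁‖ ^ 2 = ‖q‖ ^ 2 + ‖⟪ν, x - x₁⟫_ℝ • ν‖ ^ 2 := by
      conv_lhs => rw [this]
      rw [norm_add_sq_real, inner_smul_right, real_inner_comm ν q, hq]
      ring
    refine (sq_le_sq₀ (norm_nonneg _) (norm_nonneg _)).1 ?_
    rw [h2]; nlinarith [sq_nonneg ‖⟪ν, x - x₁⟫_ℝ • ν‖]
  have hb : ⟪ν, h⁻¹ • q⟫_ℝ = 0 := by rw [inner_smul_right, hq, mul_zero]
  refine ⟨h⁻¹ • q, hb, ?_, ?_⟩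
  · rw [norm_smul, Real.norm_eq_abs, abs_of_pos (inv_pos.2 h0), mul_right_comm,
      inv_mul_cancel₀ h0.ne', one_mul]
    refine hqn.trans ?_
    have := norm_sub_le_norm_sub_add_norm_sub x z₀ x₁
    rw [norm_sub_rev z₀] at this
    linarith
  · have e : shear ν (h⁻¹ • q) (x - x₁) = s • (h⁻¹ • q) + (s - h) • ν := by
      have h1 : x - x₁ = h • (h⁻¹ • q) + (s - h) • ν := by
        rw [smul_smul, mul_inv_cancel₀ h0.ne', one_smul, ← hs]; simp [q]
      rw [shear_apply, hs]
      conv_lhs => rw [h1]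
      module
    rw [e, norm_add_sq_real, norm_smul s, norm_smul (s - h), inner_smul_left, inner_smul_right,
      real_inner_comm ν (h⁻¹ • q), hb, hν]
    simp only [mul_zero, Real.norm_eq_abs, mul_one, mul_pow, sq_abs]
    ring

theorem abs_inner_le_of_norm_eq_one {ν : Eucl n} (hν : ‖ν‖ = 1) (v : Eucl n) :
    |⟪ν, v⟫_ℝ| ≤ ‖v‖ := by
  simpa [hν] using abs_real_inner_le_norm ν v

theorem le_exp_neg_sub_exp_neg {x y : ℝ} : Real.exp (-y) * (y - x) ≤
    Real.exp (-x) - Real.exp (-y) := by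
  have h1 : Real.exp (-x) = Real.exp (-y) * Real.exp (y - x) := by
    rw [← Real.exp_add]; congr 1; ring
  have h2 := Real.add_one_le_exp (y - x)
  rw [h1]
  nlinarith [Real.exp_pos (-y)]

/-- If `u` exceeds the linear function of slope `a` by a definite amount at some point at small
distance from `z₀`, then the slope of linear functions below `u` near `z₀` improves. -/
theorem exists_slope_improvement {F : Eucl n → ℝ → Eucl n → Eucl n}
    {F₀ : Eucl n → ℝ → Eucl n → ℝ} (hF : H0 F F₀) (hell : H1 F) {z₀ : Eucl n} {r : ℝ}
    (hr : closedBall z₀ r ⊆ ball (0 : Eucl n) 1) (hr0 : 0 < r) (hr1 : r ≤ 1) {u : Eucl n → ℝ}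
    {L : ℝ≥0} (hu : LipschitzWith L u) (huz : u z₀ = 0) {ν : Eucl n} (hν : ‖ν‖ = 1)
    (hsup : WeakSupersolution F F₀ u (ball z₀ r ∩ {x | 0 < ⟪ν, x - z₀⟫_ℝ})) {κ : ℝ} (hκ : 0 < κ) :
    ∃ c : ℝ, 0 < c ∧ ∀ a ε δ₀ : ℝ, |a| ≤ L → 0 < ε → ε ≤ 1 → 0 < δ₀ →
      (∀ x ∈ ball z₀ δ₀, 0 ≤ ⟪ν, x - z₀⟫_ℝ → (a - ε) * ⟪ν, x - z₀⟫_ℝ ≤ u x) →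
      ∃ t₀ : ℝ, 0 < t₀ ∧ ∀ x₀, 0 ≤ ⟪ν, x₀ - z₀⟫_ℝ → 0 < ‖x₀ - z₀‖ → ‖x₀ - z₀‖ < t₀ →
        a * ⟪ν, x₀ - z₀⟫_ℝ + κ * ‖x₀ - z₀‖ < u x₀ →
        ∃ δ : ℝ, 0 < δ ∧ ∀ x ∈ ball z₀ δ, 0 < ⟪ν, x - z₀⟫_ℝ →
          (a - ε + c) * ⟪ν, x - z₀⟫_ℝ ≤ u x := by
  have hL0 : (0 : ℝ) ≤ L := L.2
  obtain ⟨K, hK, hbar⟩ := exists_shear_barrier hF hell hr (M := L + 4) (by positivity)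
  obtain ⟨ρ, hρ0, hρ1, hρκ⟩ : ∃ ρ : ℝ, 0 < ρ ∧ ρ ≤ 1 / 2 ∧ 4 * L * ρ ≤ κ / 2 := by
    refine ⟨min (1 / 2) (κ / (8 * (L + 1))), by positivity, min_le_left _ _, ?_⟩
    have h1 := min_le_right (1 / 2) (κ / (8 * ((L : ℝ) + 1)))
    rw [le_div_iff₀ (by positivity)] at h1
    have h2 : 0 < min (1 / 2) (κ / (8 * ((L : ℝ) + 1))) := by positivity
    nlinarith
  obtain ⟨τ, hτ⟩ : ∃ τ : ℝ, τ = 1 + 3 / ρ := ⟨_, rfl⟩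
  have hτ0 : 0 < τ := by rw [hτ]; positivity
  obtain ⟨α, hα0, hαρ⟩ : ∃ α : ℝ, 0 < α ∧ α * ρ ^ 2 = K * τ ^ 6 :=
    ⟨K * τ ^ 6 / ρ ^ 2, by positivity, div_mul_cancel₀ _ (by positivity)⟩
  obtain ⟨s, hs0, hs1, hsκ, hsτ⟩ : ∃ s : ℝ, 0 < s ∧ s ≤ 1 ∧ s ≤ κ / 2 ∧ 4 * α * s * τ ≤ 1 := by
    refine ⟨min 1 (min (κ / 2) (1 / (4 * α * τ))), by positivity, min_le_left _ _,
      (min_le_right _ _).trans (min_le_left _ _), ?_⟩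
    have h1 := (min_le_right 1 (min (κ / 2) (1 / (4 * α * τ)))).trans (min_le_right _ _)
    rw [le_div_iff₀ (by positivity)] at h1
    linarith
  obtain ⟨e, he0, he⟩ : ∃ e : ℝ, 0 < e ∧ e = Real.exp (-(4 * α)) := ⟨_, Real.exp_pos _, rfl⟩
  refine ⟨s * e * α * ρ, by positivity, ?_⟩
  intro a ε δ₀ ha hε0 hε1 hδ₀ hlow
  refine ⟨min (min (r / (2 * τ + 3)) (δ₀ / (2 * τ + 3)))
    (2 * α ^ 2 * s * ρ ^ 2 * e / (K * τ ^ 4)), by positivity, ?_⟩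
  intro x₀ hx₀ ht0 ht hviol
  generalize ht_eq : ‖x₀ - z₀‖ = t at ht0 ht hviol
  obtain ⟨⟨htr, htδ⟩, htK⟩ : ((2 * τ + 3) * t < r ∧ (2 * τ + 3) * t < δ₀) ∧
      K * τ ^ 4 * t < 2 * α ^ 2 * s * ρ ^ 2 * e := by
    rw [lt_min_iff, lt_min_iff, lt_div_iff₀ (by positivity), lt_div_iff₀ (by positivity),
      lt_div_iff₀ (by positivity)] at ht
    refine ⟨⟨?_, ?_⟩, ?_⟩ <;> linarith [ht.1.1, ht.1.2, ht.2]
  have hτt : 0 < τ * t := by positivity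
  have ht1 : t ≤ 1 := by linarith
  have hρt : ρ * t ≤ t := mul_le_of_le_one_left ht0.le (by linarith)
  obtain ⟨x₁, hx₁⟩ : ∃ x₁ : Eucl n, x₁ = x₀ + (ρ * t) • ν := ⟨_, rfl⟩
  have hx₁₀ : ‖x₁ - x₀‖ = ρ * t := by
    simp only [hx₁, add_sub_cancel_left, norm_smul, hν, mul_one, Real.norm_eq_abs]
    exact abs_of_pos (by positivity)
  have hx₁z : ‖x₁ - z₀‖ ≤ 2 * t := by
    have := norm_sub_le_norm_sub_add_norm_sub x₁ x₀ z₀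
    rw [hx₁₀, ht_eq] at this
    linarith
  have hh : ⟪ν, x₁ - z₀⟫_ℝ = ⟪ν, x₀ - z₀⟫_ℝ + ρ * t := by
    have : x₁ - z₀ = (x₀ - z₀) + (ρ * t) • ν := by rw [hx₁]; abel
    rw [this, inner_add_right, inner_smul_right, real_inner_self_eq_norm_sq, hν]; ring
  generalize hh_eq : ⟪ν, x₁ - z₀⟫_ℝ = h at hh
  have hhρ : ρ * t ≤ h := by linarith
  have hh0 : 0 < h := lt_of_lt_of_le (by positivity) hhρ
  have hh2 : h ≤ 2 * t :=
    hh_eq ▸ (le_abs_self _).trans ((abs_inner_le_of_norm_eq_one hν _).trans hx₁z)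
  obtain ⟨δ, hδ0, hδ⟩ : ∃ δ : ℝ, 0 < δ ∧ δ * (ρ ^ 2 + 9) = ρ ^ 3 * t :=
    ⟨ρ ^ 3 / (ρ ^ 2 + 9) * t, by positivity, by field_simp⟩
  have hδt : δ ≤ t := by
    have h2 : ρ ^ 3 * t ≤ 1 * t := by gcongr; exact pow_le_one₀ hρ0.le (by linarith)
    have h3 : δ ≤ δ * (ρ ^ 2 + 9) := le_mul_of_one_le_right hδ0.le (by linarith [sq_nonneg ρ])
    linarith
  refine ⟨δ, hδ0, fun x hx hxν => ?_⟩
  rw [mem_ball_iff_norm] at hx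
  obtain ⟨b, hb, hbn, hφ⟩ := exists_shear_vector (x := x) hν (hh_eq ▸ hh0)
  rw [hh_eq] at hbn hφ
  have hb3 : ‖b‖ ≤ 3 / ρ := by
    rw [le_div_iff₀ hρ0]
    have h1 : ‖b‖ * (ρ * t) ≤ 3 * t := by
      calc ‖b‖ * (ρ * t) ≤ ‖b‖ * h := by gcongr
        _ ≤ _ := hbn
        _ ≤ 3 * t := by linarith
    exact le_of_mul_le_mul_right (by rwa [mul_assoc]) ht0
  have hbτ : 1 + ‖b‖ ≤ τ := by rw [hτ]; linarith
  have hbh : (1 + ‖b‖) * h ≤ 2 * τ * t := by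
    calc (1 + ‖b‖) * h ≤ τ * (2 * t) := by gcongr
      _ = _ := by ring
  obtain ⟨β, hβ0, hβt⟩ : ∃ β : ℝ, 0 < β ∧ β * t ^ 2 = α :=
    ⟨α / t ^ 2, by positivity, div_mul_cancel₀ _ (by positivity)⟩
  have hβh : β * h ^ 2 ≤ 4 * α := by
    have : h ^ 2 ≤ (2 * t) ^ 2 := by gcongr
    calc β * h ^ 2 ≤ β * (2 * t) ^ 2 := by gcongr
      _ = _ := by rw [← hβt]; ring
  have heh : e ≤ Real.exp (-β * h ^ 2) := he ▸ Real.exp_le_exp.2 (by linarith)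
  have hm : |a - ε| ≤ L + 1 := by
    refine (abs_sub _ _).trans ?_
    rw [abs_of_pos hε0]; linarith
  have hshear : ‖shear ν b (x - x₁)‖ ^ 2 ≤ h ^ 2 - h * ⟪ν, x - z₀⟫_ℝ := by
    have hp : ⟪ν, x - z₀⟫_ℝ ≤ δ :=
      (le_abs_self _).trans ((abs_inner_le_of_norm_eq_one hν _).trans hx.le)
    have h2 : ⟪ν, x - z₀⟫_ℝ * (1 + ‖b‖ ^ 2) ≤ h := by
      have h3 : ‖b‖ ^ 2 ≤ (3 / ρ) ^ 2 := by gcongr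
      calc ⟪ν, x - z₀⟫_ℝ * (1 + ‖b‖ ^ 2) ≤ δ * (1 + (3 / ρ) ^ 2) := by gcongr
        _ = δ * (ρ ^ 2 + 9) / ρ ^ 2 := by field_simp; ring
        _ = ρ * t := by rw [hδ]; field_simp
        _ ≤ h := hhρ
    have h3 := mul_le_mul_of_nonneg_left h2 hxν.le
    rw [hφ]
    linarith
  have key := hbar u L ν b x₁ (a - ε) (s * t) β (ρ * t) h hu (by linarith) ?_ hν hb hsup
    hh_eq.symm hh0
    (by positivity) hβ0 (by positivity) (by linarith) ?_ ?_ ?_ ?_ ?_ ?_ x ?_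
  · refine le_trans ?_ key
    have h2 := le_exp_neg_sub_exp_neg (x := β * ‖shear ν b (x - x₁)‖ ^ 2) (y := β * h ^ 2)
    rw [← neg_mul, ← neg_mul] at h2
    have h3 : e * (β * (h * ⟪ν, x - z₀⟫_ℝ)) ≤
        Real.exp (-β * ‖shear ν b (x - x₁)‖ ^ 2) - Real.exp (-β * h ^ 2) := by
      refine le_trans ?_ h2
      rw [← mul_sub]
      gcongr
      linarith
    have h4 : s * e * α * ρ * ⟪ν, x - z₀⟫_ℝ ≤ s * t * (e * (β * (h * ⟪ν, x - z₀⟫_ℝ))) := by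
      calc s * e * α * ρ * ⟪ν, x - z₀⟫_ℝ
          = s * t * (e * (β * ((ρ * t) * ⟪ν, x - z₀⟫_ℝ))) := by rw [← hβt]; ring
        _ ≤ _ := by gcongr
    have h5 := mul_le_mul_of_nonneg_left h3 (by positivity : 0 ≤ s * t)
    linarith
  · intro y hy
    have h1 := hu.dist_le_mul y z₀
    rw [huz, Real.dist_eq, sub_zero] at h1
    have h2 : dist y z₀ ≤ 1 := (mem_closedBall.1 hy).trans hr1
    have h3 : (L : ℝ) * dist y z₀ ≤ L * 1 := by gcongr
    linarith
  · intro y hy hyν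
    refine hlow y ?_ hyν
    rw [mem_ball_iff_norm]
    have := norm_sub_le_norm_sub_add_norm_sub y x₁ z₀
    linarith
  · intro y hy hyν
    have h1 : ‖y - x₀‖ ≤ 2 * (ρ * t) := by
      have := norm_sub_le_norm_sub_add_norm_sub y x₁ x₀
      linarith
    have h2 : u x₀ - u y ≤ L * (2 * (ρ * t)) := by
      refine (le_abs_self _).trans ?_
      rw [← Real.dist_eq]
      refine (hu.dist_le_mul _ _).trans ?_
      rw [dist_comm, dist_eq_norm]
      gcongr
    have h3 : a * ⟪ν, y - z₀⟫_ℝ - a * ⟪ν, x₀ - z₀⟫_ℝ ≤ L * (2 * (ρ * t)) := by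
      rw [← mul_sub, ← inner_sub_right, sub_sub_sub_cancel_right]
      refine (le_abs_self _).trans ?_
      rw [abs_mul]
      gcongr
      exact (abs_inner_le_of_norm_eq_one hν _).trans h1
    have h4 : 4 * L * ρ * t ≤ κ / 2 * t := by gcongr
    have h5 : s * t ≤ κ / 2 * t := by gcongr
    have h6 : 0 ≤ ε * ⟪ν, y - z₀⟫_ℝ := by positivity
    linarith
  · have h1 : |a - ε| * r ≤ (L + 1) * 1 := by gcongr
    have h2 : s * t ≤ 1 := mul_le_one₀ hs1 ht0.le ht1
    linarith
  · have h1 : 2 * β * (s * t) * ((1 + ‖b‖) * h) ≤ 2 * β * (s * t) * (2 * τ * t) := by gcongr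
    have h2 : 2 * β * (s * t) * (2 * τ * t) = 4 * α * s * τ := by rw [← hβt]; ring
    linarith
  · calc K * (1 + ‖b‖) ^ 6 ≤ K * τ ^ 6 := by gcongr
      _ = β * (ρ * t) ^ 2 := by rw [← hαρ, ← hβt]; ring
  · have h1 : K * (1 + ‖b‖) ^ 4 ≤ K * τ ^ 4 := by gcongr
    have h2 : 2 * β ^ 2 * (s * t * e) * (ρ * t) ^ 2 ≤
        2 * β ^ 2 * (s * t * Real.exp (-β * h ^ 2)) * (ρ * t) ^ 2 := by gcongr
    refine (h1.trans ?_).trans h2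
    refine le_of_mul_le_mul_right ?_ ht0
    refine htK.le.trans (le_of_eq ?_)
    rw [← hβt]; ring
  · linarith [mul_pos hh0 hxν]

/-- A weak supersolution in a half ball which is nonnegative on the flat part of the boundary has
a normal linear expansion at each of its zeros on the flat part. -/
theorem exists_linear_expansion {F : Eucl n → ℝ → Eucl n → Eucl n}
    {F₀ : Eucl n → ℝ → Eucl n → ℝ} (hF : H0 F F₀) (hell : H1 F) {z₀ : Eucl n} {r : ℝ}
    (hr : closedBall z₀ r ⊆ ball (0 : Eucl n) 1) (hr0 : 0 < r) (hr1 : r ≤ 1) {u : Eucl n → ℝ}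
    {L : ℝ≥0} (hu : LipschitzWith L u) (huz : u z₀ = 0) {ν : Eucl n} (hν : ‖ν‖ = 1)
    (hthin : ∀ x ∈ ball z₀ r, ⟪ν, x - z₀⟫_ℝ = 0 → 0 ≤ u x)
    (hsup : WeakSupersolution F F₀ u (ball z₀ r ∩ {x | 0 < ⟪ν, x - z₀⟫_ℝ})) :
    ∃ a : ℝ, ∀ κ : ℝ, 0 < κ → ∃ δ : ℝ, 0 < δ ∧ ∀ x ∈ ball z₀ δ, 0 ≤ ⟪ν, x - z₀⟫_ℝ →
      |u x - a * ⟪ν, x - z₀⟫_ℝ| ≤ κ * ‖x - z₀‖ := by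
  have hνν : ⟪ν, ν⟫_ℝ = 1 := by rw [real_inner_self_eq_norm_sq, hν, one_pow]
  set S : Set ℝ := {m | ∃ δ : ℝ, 0 < δ ∧ ∀ x ∈ ball z₀ δ, 0 ≤ ⟪ν, x - z₀⟫_ℝ →
    m * ⟪ν, x - z₀⟫_ℝ ≤ u x}
  have hSL : -(L : ℝ) ∈ S := by
    refine ⟨r / 2, by positivity, fun x hx hxν => ?_⟩
    set p := ⟪ν, x - z₀⟫_ℝ
    rw [mem_ball_iff_norm] at hx
    have hp : |p| ≤ ‖x - z₀‖ := abs_inner_le_of_norm_eq_one hν _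
    have hn : ‖p • ν‖ = p := by rw [norm_smul, hν, mul_one, Real.norm_eq_abs, abs_of_nonneg hxν]
    have h1 : 0 ≤ u (x - p • ν) := by
      apply hthin
      · rw [mem_ball_iff_norm, sub_right_comm]
        refine (norm_sub_le _ _).trans_lt ?_
        rw [hn]
        linarith [le_abs_self p]
      · rw [sub_right_comm, inner_sub_right, inner_smul_right, hνν, mul_one, sub_self]
    have h2 := hu.dist_le_mul (x - p • ν) x
    rw [dist_eq_norm, dist_eq_norm, sub_sub_cancel_left, norm_neg, hn, Real.norm_eq_abs] at h2
    linarith [le_abs_self (u (x - p • ν) - u x)]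
  have hSb : ∀ m ∈ S, m ≤ L := by
    rintro m ⟨δ, hδ, hm⟩
    have h1 := hm (z₀ + (δ / 2) • ν) (by
      rw [mem_ball_iff_norm, add_sub_cancel_left, norm_smul, hν, mul_one, Real.norm_eq_abs,
        abs_of_pos (by positivity)]; linarith)
    rw [add_sub_cancel_left, inner_smul_right, hνν, mul_one] at h1
    have h2 := hu.dist_le_mul (z₀ + (δ / 2) • ν) z₀
    rw [huz, Real.dist_eq, sub_zero, dist_eq_norm, add_sub_cancel_left, norm_smul, hν, mul_one,
      Real.norm_eq_abs, abs_of_pos (half_pos hδ)] at h2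
    have h3 := h1 (by positivity)
    have h4 : m * (δ / 2) ≤ L * (δ / 2) := by linarith [le_abs_self (u (z₀ + (δ / 2) • ν))]
    exact le_of_mul_le_mul_right h4 (by positivity)
  have hbdd : BddAbove S := ⟨L, hSb⟩
  set a := sSup S
  have haL : |a| ≤ L := abs_le.2 ⟨le_csSup hbdd hSL, csSup_le ⟨_, hSL⟩ hSb⟩
  have hlow : ∀ ε : ℝ, 0 < ε → ∃ δ : ℝ, 0 < δ ∧ ∀ x ∈ ball z₀ δ, 0 ≤ ⟪ν, x - z₀⟫_ℝ →
      (a - ε) * ⟪ν, x - z₀⟫_ℝ ≤ u x := by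
    intro ε hε
    obtain ⟨m, ⟨δ, hδ, hm⟩, hma⟩ := exists_lt_of_lt_csSup ⟨_, hSL⟩ (sub_lt_self a hε)
    exact ⟨δ, hδ, fun x hx hxν => le_trans (by gcongr) (hm x hx hxν)⟩
  refine ⟨a, fun κ hκ => ?_⟩
  obtain ⟨δ₁, hδ₁, hδ₁u⟩ := hlow κ hκ
  obtain ⟨c, hc, himp⟩ := exists_slope_improvement hF hell hr hr0 hr1 hu huz hν hsup hκ
  set ε : ℝ := min 1 (c / 2)
  have hε : 0 < ε := by positivity
  obtain ⟨δ₀, hδ₀, hδ₀u⟩ := hlow ε hε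
  obtain ⟨t₀, ht₀, ht₀u⟩ := himp a ε δ₀ haL hε (min_le_left _ _) hδ₀ hδ₀u
  refine ⟨min δ₁ t₀, by positivity, fun x hx hxν => ?_⟩
  have hx1 : x ∈ ball z₀ δ₁ := ball_subset_ball (min_le_left _ _) hx
  have hx2 := mem_ball_iff_norm.1 (ball_subset_ball (min_le_right _ _) hx)
  have hpx : ⟪ν, x - z₀⟫_ℝ ≤ ‖x - z₀‖ :=
    (le_abs_self _).trans (abs_inner_le_of_norm_eq_one hν _)
  rw [abs_le]
  constructor
  · have h1 := hδ₁u x hx1 hxν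
    nlinarith
  · by_contra! hn
    rcases (norm_nonneg (x - z₀)).eq_or_lt with h0 | h0
    · have : x = z₀ := sub_eq_zero.1 (norm_eq_zero.1 h0.symm)
      subst this
      simp [huz] at hn
    obtain ⟨δ, hδ, hδu⟩ := ht₀u x hxν h0 hx2 (by linarith)
    have hmem : a + c / 2 ∈ S := by
      refine ⟨min δ r, by positivity, fun y hy hyν => ?_⟩
      rcases hyν.eq_or_lt with h | h
      · rw [← h, mul_zero]
        exact hthin y (ball_subset_ball (min_le_right _ _) hy) h.symm
      · refine le_trans ?_ (hδu y (ball_subset_ball (min_le_left _ _) hy) h)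
        exact mul_le_mul_of_nonneg_right (by linarith [min_le_right 1 (c / 2)]) h.le
    linarith [le_csSup hbdd hmem]

/-- The quadratic barrier `p ⟪e, x - z₀⟫ + σ (k ⟪e, x - z₀⟫² - |x - y|²) + d`. -/
def kinkBarrier (e z₀ y : Eucl n) (p σ k d : ℝ) (x : Eucl n) : ℝ :=
  p * ⟪e, x - z₀⟫_ℝ + σ * (k * ⟪e, x - z₀⟫_ℝ ^ 2 - ‖x - y‖ ^ 2) + d

theorem hasGradientAt_kinkBarrier (e z₀ y : Eucl n) (p σ k d : ℝ) (x : Eucl n) :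
    HasGradientAt (kinkBarrier e z₀ y p σ k d)
      (p • e + (2 * σ) • ((k * ⟪e, x - z₀⟫_ℝ) • e - (x - y))) x := by
  have h0 : HasFDerivAt (fun x : Eucl n => ⟪e, x - z₀⟫_ℝ) (innerSL ℝ e) x :=
    (innerSL ℝ e).hasFDerivAt.comp x ((hasFDerivAt_id x).sub_const z₀)
  have h1 : HasFDerivAt (fun x : Eucl n => ‖x - y‖ ^ 2)
      (2 • (innerSL ℝ (x - y)).comp (ContinuousLinearMap.id ℝ (Eucl n))) x :=
    ((hasFDerivAt_id x).sub_const y).norm_sq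
  rw [hasGradientAt_iff_hasFDerivAt]
  unfold kinkBarrier
  convert! ((h0.const_mul p).add
    ((((h0.pow 2).const_mul k).sub h1).const_mul σ)).add_const d using 1
  ext v
  simp
  ring

theorem hasFDerivAt_kinkBarrier_gradient (e z₀ y : Eucl n) (p σ k : ℝ) (x : Eucl n) :
    HasFDerivAt (fun x => p • e + (2 * σ) • ((k * ⟪e, x - z₀⟫_ℝ) • e - (x - y)))
      ((2 * σ * k) • (innerSL ℝ e).smulRight e -
        (2 * σ) • ContinuousLinearMap.id ℝ (Eucl n)) x := by
  have h0 : HasFDerivAt (fun x : Eucl n => ⟪e, x - z₀⟫_ℝ) (innerSL ℝ e) x :=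
    (innerSL ℝ e).hasFDerivAt.comp x ((hasFDerivAt_id x).sub_const z₀)
  have h1 : HasFDerivAt (fun x : Eucl n => x - y) (ContinuousLinearMap.id ℝ (Eucl n)) x :=
    (hasFDerivAt_id x).sub_const y
  convert! ((((h0.const_mul k).smul_const e).sub h1).const_smul (2 * σ)).const_add (p • e) using 1
  ext1 v
  simp [smul_smul]
  module

/-- A weak supersolution lying above a convex kink is bounded below by the quadratic barrier. -/
theorem exists_kink_constant {F : Eucl n → ℝ → Eucl n → Eucl n}
    {F₀ : Eucl n → ℝ → Eucl n → ℝ} (hF : H0 F F₀) (hell : H1 F) {z₀ : Eucl n} {r : ℝ}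
    (hr : closedBall z₀ r ⊆ ball (0 : Eucl n) 1) {M : ℝ} (hM : 0 < M) :
    ∃ K : ℝ, 0 < K ∧ ∀ (w : Eucl n → ℝ) (L : ℝ≥0) (e y : Eucl n) (p c k t γ ε : ℝ),
      LipschitzWith L w → L ≤ M → (∀ x ∈ closedBall z₀ r, |w x| ≤ M) → ‖e‖ = 1 →
      ⟪e, y - z₀⟫_ℝ = 0 → ‖y - z₀‖ ≤ t / 2 → 0 < t → t ≤ r → t ≤ 1 → 0 < c → 1 ≤ k → 2 * K ≤ k →
      K * t ≤ c → |p| + 5 * c + 1 ≤ M → 0 ≤ γ → 0 ≤ ε → γ + ε ≤ c / k / 4 →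
      (∀ x ∈ closedBall z₀ t,
        p * ⟪e, x - z₀⟫_ℝ + c * |⟪e, x - z₀⟫_ℝ| - ε * t ≤ w x) →
      (∀ (ψ : Eucl n → ℝ) (C : ℝ≥0), LipschitzWith C ψ → tsupport ψ ⊆ ball z₀ t →
        (∀ x, 0 ≤ ψ x) → (∀ x, ψ x ≤ max (kinkBarrier e z₀ y p (c / k / t) k (γ * t) x - w x) 0) →
        0 ≤ ∫ x, weakIntegrand F F₀ w ψ x) →
      γ * t ≤ w y := by
  obtain ⟨K, hK, hcomp⟩ := exists_comparison_constant hF hell hr hM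
  refine ⟨K, hK, ?_⟩
  intro w L e y p c k t γ ε hw hLM hwM he hey hy ht htr ht1 hc hk hkK hKt hpM hγ hε hγε hlow hweak
  obtain ⟨s, hs⟩ : ∃ s, s = c / k := ⟨_, rfl⟩
  have hk0 : 0 < k := by linarith
  have hs0 : 0 < s := by rw [hs]; positivity
  have hsk : s * k = c := by rw [hs, div_mul_cancel₀ _ hk0.ne']
  have hsc : s ≤ c := by rw [← hsk]; exact le_mul_of_one_le_right hs0.le hk
  rw [← hs] at hγε hweak
  obtain ⟨σ, hσ⟩ : ∃ σ, σ = s / t := ⟨_, rfl⟩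
  have hσ0 : 0 < σ := by rw [hσ]; positivity
  have hσt : σ * t = s := by rw [hσ, div_mul_cancel₀ _ ht.ne']
  rw [← hσ] at hweak
  have hX : ∀ x ∈ closedBall z₀ t, |⟪e, x - z₀⟫_ℝ| ≤ t := fun x hx =>
    (abs_inner_le_of_norm_eq_one he _).trans (mem_closedBall_iff_norm.1 hx)
  have hxy : ∀ x ∈ closedBall z₀ t, ‖x - y‖ ≤ 3 / 2 * t := fun x hx => by
    have h1 := norm_sub_le_norm_sub_add_norm_sub x z₀ y
    rw [norm_sub_rev z₀ y] at h1
    linarith [mem_closedBall_iff_norm.1 hx]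
  have hγs : γ ≤ s := by linarith
  have hy_eq : kinkBarrier e z₀ y p σ k (γ * t) y = γ * t := by
    simp [kinkBarrier, hey]
  have main := hcomp w _ _ _ L (ball z₀ t) hw hLM hwM
    (hasGradientAt_kinkBarrier e z₀ y p σ k (γ * t))
    (hasFDerivAt_kinkBarrier_gradient e z₀ y p σ k) continuous_const isOpen_ball
    (ball_subset_ball htr) ?_ ?_ ?_ hweak y (by rw [mem_ball_iff_norm]; linarith)
  · rwa [hy_eq] at main
  · intro x hx
    have h1 := hX x (ball_subset_closedBall hx)
    have h2 := hxy x (ball_subset_closedBall hx)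
    constructor
    · have e1 : |p * ⟪e, x - z₀⟫_ℝ| ≤ |p| * 1 := by
        rw [abs_mul]; gcongr; linarith
      have e2 : ⟪e, x - z₀⟫_ℝ ^ 2 ≤ t ^ 2 := sq_le_sq' (abs_le.1 h1).1 (abs_le.1 h1).2
      have e3 : ‖x - y‖ ^ 2 ≤ (3 / 2 * t) ^ 2 := by gcongr
      have e4 : σ * (k * ⟪e, x - z₀⟫_ℝ ^ 2) ≤ c := by
        calc σ * (k * ⟪e, x - z₀⟫_ℝ ^ 2) ≤ σ * (k * t ^ 2) := by gcongr
          _ = c * t := by rw [← hsk, ← hσt]; ring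
          _ ≤ c := mul_le_of_le_one_right hc.le ht1
      have e5 : σ * ‖x - y‖ ^ 2 ≤ 3 * c := by
        calc σ * ‖x - y‖ ^ 2 ≤ σ * (3 / 2 * t) ^ 2 := by gcongr
          _ = 9 / 4 * (s * t) := by rw [← hσt]; ring
          _ ≤ 9 / 4 * s := by
            gcongr; exact mul_le_of_le_one_right hs0.le ht1
          _ ≤ 3 * c := by linarith
      have e6 : γ * t ≤ c := (mul_le_of_le_one_right hγ ht1).trans (hγs.trans hsc)
      have e7 : 0 ≤ σ * (k * ⟪e, x - z₀⟫_ℝ ^ 2) := by positivity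
      have e8 : 0 ≤ σ * ‖x - y‖ ^ 2 := by positivity
      have e9 : 0 ≤ γ * t := by positivity
      have e10 : |kinkBarrier e z₀ y p σ k (γ * t) x| ≤ |p| + 5 * c := by
        unfold kinkBarrier
        rw [abs_le] at e1 ⊢
        constructor <;> rw [mul_sub] <;> linarith
      linarith
    · have e1 : ‖(k * ⟪e, x - z₀⟫_ℝ) • e‖ ≤ k * t := by
        rw [norm_smul, he, mul_one, Real.norm_eq_abs, abs_mul, abs_of_pos hk0]
        gcongr
      have e2 : ‖(k * ⟪e, x - z₀⟫_ℝ) • e - (x - y)‖ ≤ k * t + 3 / 2 * t :=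
        (norm_sub_le _ _).trans (add_le_add e1 h2)
      calc ‖p • e + (2 * σ) • ((k * ⟪e, x - z₀⟫_ℝ) • e - (x - y))‖
          ≤ |p| + 2 * σ * (k * t + 3 / 2 * t) := by
            refine (norm_add_le _ _).trans ?_
            rw [norm_smul, norm_smul, he, mul_one, Real.norm_eq_abs, Real.norm_eq_abs,
              abs_of_pos (by positivity : 0 < 2 * σ)]
            gcongr
        _ = |p| + 2 * c + 3 * s := by rw [← hsk, ← hσt]; ring
        _ ≤ M := by linarith
  · intro x hx
    rw [frontier_ball _ ht.ne'] at hx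
    have hx' := sphere_subset_closedBall hx
    refine le_trans ?_ (hlow x hx')
    rw [mem_sphere_iff_norm] at hx
    have h1 := hX x hx'
    have h2 : t / 2 ≤ ‖x - y‖ := by
      have := norm_sub_le_norm_sub_add_norm_sub x y z₀
      linarith
    have h3 : (t / 2) ^ 2 ≤ ‖x - y‖ ^ 2 := by gcongr
    have h4 : σ * (k * ⟪e, x - z₀⟫_ℝ ^ 2) ≤ c * |⟪e, x - z₀⟫_ℝ| := by
      calc σ * (k * ⟪e, x - z₀⟫_ℝ ^ 2)
          = σ * k * (|⟪e, x - z₀⟫_ℝ| * |⟪e, x - z₀⟫_ℝ|) := by rw [← sq_abs]; ring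
        _ ≤ σ * k * (t * |⟪e, x - z₀⟫_ℝ|) := by gcongr
        _ = c * |⟪e, x - z₀⟫_ℝ| := by rw [← hsk, ← hσt]; ring
    have h5 : s * t / 4 ≤ σ * ‖x - y‖ ^ 2 := by
      calc s * t / 4 = σ * (t / 2) ^ 2 := by rw [← hσt]; ring
        _ ≤ _ := by gcongr
    have h6 : (γ + ε) * t ≤ s / 4 * t := by gcongr
    unfold kinkBarrier
    linarith
  · intro x _ _
    refine ⟨2 * σ * k, e, (2 * σ) • ContinuousLinearMap.id ℝ (Eucl n), by positivity, rfl, ?_⟩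
    rw [he, one_pow, mul_one, norm_smul, Real.norm_eq_abs, abs_of_pos (by positivity)]
    have h1 : 2 * σ * ‖ContinuousLinearMap.id ℝ (Eucl n)‖ ≤ 2 * σ * 1 := by
      gcongr; exact ContinuousLinearMap.norm_id_le
    have h2 : K ≤ σ * k := by
      refine le_of_mul_le_mul_right ?_ ht
      calc K * t ≤ c := hKt
        _ = σ * k * t := by rw [← hsk, ← hσt]; ring
    have h3 : σ * (2 * K) ≤ σ * k := by gcongr
    calc K * (1 + 2 * σ * ‖ContinuousLinearMap.id ℝ (Eucl n)‖) ≤ K * (1 + 2 * σ * 1) := by gcongr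
      _ = K + σ * (2 * K) := by ring
      _ ≤ 2 * σ * k := by linarith

/-- A function with a strictly convex kink along the thin plane which is a supersolution against
suitable test functions cannot be small at points of that plane. -/
theorem exists_kink_bound {F : Eucl n → ℝ → Eucl n → Eucl n}
    {F₀ : Eucl n → ℝ → Eucl n → ℝ} (hF : H0 F F₀) (hell : H1 F) {z₀ : Eucl n} {r : ℝ}
    (hr : closedBall z₀ r ⊆ ball (0 : Eucl n) 1) (hr0 : 0 < r) {w : Eucl n → ℝ}
    {L : ℝ≥0} (hw : LipschitzWith L w) {ν : Eucl n} (hν : ‖ν‖ = 1) {a b : ℝ} (hba : b < a)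
    (hexp : ∀ κ : ℝ, 0 < κ → ∃ δ : ℝ, 0 < δ ∧ ∀ x ∈ ball z₀ δ,
      (0 ≤ ⟪ν, x - z₀⟫_ℝ → |w x - a * ⟪ν, x - z₀⟫_ℝ| ≤ κ * ‖x - z₀‖) ∧
      (⟪ν, x - z₀⟫_ℝ ≤ 0 → |w x - b * ⟪ν, x - z₀⟫_ℝ| ≤ κ * ‖x - z₀‖)) :
    ∃ θ : ℝ, 0 < θ ∧ ∃ δ : ℝ, 0 < δ ∧ δ ≤ r ∧ ∀ t : ℝ, 0 < t → t < δ → ∀ y : Eucl n,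
      ⟪ν, y - z₀⟫_ℝ = 0 → ‖y - z₀‖ ≤ t / 2 → ∀ γ : ℝ, 0 ≤ γ → γ ≤ θ →
      (∀ (ψ : Eucl n → ℝ) (C : ℝ≥0), LipschitzWith C ψ → tsupport ψ ⊆ ball z₀ t →
        (∀ x, 0 ≤ ψ x) → (∀ x, ⟪ν, x - z₀⟫_ℝ = 0 → ψ x ≤ max (γ * t - w x) 0) →
        0 ≤ ∫ x, weakIntegrand F F₀ w ψ x) →
      γ * t ≤ w y := by
  obtain ⟨W, hW⟩ := (isCompact_closedBall z₀ r).exists_bound_of_continuousOn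
    hw.continuous.continuousOn
  have hW0 : 0 ≤ W := (norm_nonneg _).trans (hW z₀ (mem_closedBall_self hr0.le))
  obtain ⟨p, hp⟩ : ∃ p, p = (a + b) / 2 := ⟨_, rfl⟩
  obtain ⟨c, hc⟩ : ∃ c, c = (a - b) / 2 := ⟨_, rfl⟩
  have hc0 : 0 < c := by linarith
  have hL0 : (0 : ℝ) ≤ L := L.2
  have hM : 0 < L + W + (|p| + 5 * c + 1) := by positivity
  obtain ⟨K, hK, hkink⟩ := exists_kink_constant hF hell hr hM
  obtain ⟨k, hk⟩ : ∃ k, k = max 1 (2 * K) := ⟨_, rfl⟩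
  have hk1 : 1 ≤ k := hk ▸ le_max_left _ _
  have hkK : 2 * K ≤ k := hk ▸ le_max_right _ _
  have hε : 0 < c / k / 8 := by positivity
  obtain ⟨δ, hδ, hδw⟩ := hexp _ hε
  refine ⟨c / k / 8, hε, min (min δ r) (min 1 (c / K)), by positivity,
    (min_le_left _ _).trans (min_le_right _ _), ?_⟩
  intro t ht htδ y hy hyt γ hγ hγθ hweak
  simp only [lt_min_iff] at htδ
  obtain ⟨⟨ht1, ht2⟩, ht3, ht4⟩ := htδ
  have habs := abs_nonneg p
  refine hkink w L ν y p c k t γ (c / k / 8) hw (by linarith)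
    (fun x hx => (hW x hx).trans (by linarith)) hν hy hyt ht ht2.le ht3.le hc0 hk1 hkK ?_
    (by linarith) hγ hε.le (by linarith) ?_ ?_
  · rw [lt_div_iff₀ hK] at ht4
    linarith
  · intro x hx
    have hxt := mem_closedBall_iff_norm.1 hx
    have hxδ : x ∈ ball z₀ δ := mem_ball_iff_norm.2 (hxt.trans_lt ht1)
    have hm : c / k / 8 * ‖x - z₀‖ ≤ c / k / 8 * t := mul_le_mul_of_nonneg_left hxt hε.le
    rcases le_total 0 ⟪ν, x - z₀⟫_ℝ with h | h
    · have h1 := (abs_le.1 ((hδw x hxδ).1 h)).1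
      rw [show a = p + c by rw [hp, hc]; ring] at h1
      rw [abs_of_nonneg h]
      linarith
    · have h1 := (abs_le.1 ((hδw x hxδ).2 h)).1
      rw [show b = p - c by rw [hp, hc]; ring] at h1
      rw [abs_of_nonpos h]
      linarith
  · intro ψ C hψ hs hψ0 hψη
    refine hweak ψ C hψ hs hψ0 fun x hx => (hψη x).trans (max_le_max ?_ le_rfl)
    have : 0 ≤ c / k / t * ‖x - y‖ ^ 2 := by positivity
    simp only [kinkBarrier, hx]
    linarith

theorem gradient_neg (w : Eucl n → ℝ) (x : Eucl n) :
    gradient (fun y => -w y) x = -gradient w x := by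
  simp only [gradient, fderiv_fun_neg, map_neg]

/-- The structure field obtained by reflecting solutions `w ↦ -w`. -/
def reflectedField (F : Eucl n → ℝ → Eucl n → Eucl n) (x : Eucl n) (z : ℝ) (p : Eucl n) :
    Eucl n :=
  -F x (-z) (-p)

/-- The lower order term obtained by reflecting solutions `w ↦ -w`. -/
def reflectedSource (F₀ : Eucl n → ℝ → Eucl n → ℝ) (x : Eucl n) (z : ℝ) (p : Eucl n) : ℝ :=
  -F₀ x (-z) (-p)

theorem H0.reflected {F : Eucl n → ℝ → Eucl n → Eucl n} {F₀ : Eucl n → ℝ → Eucl n → ℝ}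
    (hF : H0 F F₀) : H0 (reflectedField F) (reflectedSource F₀) := by
  have hg : ContDiffOn ℝ 1 (fun q : Eucl n × ℝ × Eucl n => (q.1, -q.2.1, -q.2.2))
      (ball (0 : Eucl n) 1 ×ˢ (Set.univ : Set ℝ) ×ˢ (Set.univ : Set (Eucl n))) := by
    fun_prop
  have hm : Set.MapsTo (fun q : Eucl n × ℝ × Eucl n => (q.1, -q.2.1, -q.2.2))
      (ball (0 : Eucl n) 1 ×ˢ (Set.univ : Set ℝ) ×ˢ (Set.univ : Set (Eucl n)))
      (ball (0 : Eucl n) 1 ×ˢ (Set.univ : Set ℝ) ×ˢ (Set.univ : Set (Eucl n))) :=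
    fun q hq => ⟨hq.1, trivial, trivial⟩
  exact ⟨(hF.1.comp hg hm).neg, (hF.2.comp hg hm).neg⟩

theorem H1.reflected {F : Eucl n → ℝ → Eucl n → Eucl n} {F₀ : Eucl n → ℝ → Eucl n → ℝ}
    (hF : H0 F F₀) (hell : H1 F) : H1 (reflectedField F) := by
  intro M hM
  obtain ⟨lam, hlam, h⟩ := hell M hM
  refine ⟨lam, hlam, fun x hx z hz p hp ξ => ?_⟩
  have h1 : HasFDerivAt (reflectedField F x z) (fderiv ℝ (F x (-z)) (-p)) p := by
    have := ((fderiv_structure_snd hF hx (-z) (-p)).1.comp p (hasFDerivAt_id p).neg).neg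
    convert! this using 1
    ext1 v
    simp
  rw [h1.fderiv]
  exact h x hx (-z) (by rwa [abs_neg]) (-p) (by rwa [norm_neg]) ξ

theorem weakIntegrand_reflected (F : Eucl n → ℝ → Eucl n → Eucl n) (F₀ : Eucl n → ℝ → Eucl n → ℝ)
    (w ψ : Eucl n → ℝ) :
    weakIntegrand (reflectedField F) (reflectedSource F₀) (fun x => -w x) ψ =
      weakIntegrand F F₀ w (fun x => -ψ x) := by
  funext x
  simp only [weakIntegrand, reflectedField, reflectedSource, gradient_neg, neg_neg,
    inner_neg_left, inner_neg_right]
  ring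

/-- First order expansion of a solution of the thin obstacle problem at a free boundary point. -/
theorem exists_linear_expansion_thin {F : Eucl n → ℝ → Eucl n → Eucl n}
    {F₀ : Eucl n → ℝ → Eucl n → ℝ} (hF : H0 F F₀) (hell : H1 F) {z₀ : Eucl n} {r : ℝ}
    (hr : closedBall z₀ r ⊆ ball (0 : Eucl n) 1) (hr0 : 0 < r) (hr1 : r ≤ 1) {u : Eucl n → ℝ}
    {L : ℝ≥0} (hu : LipschitzWith L u) (huz : u z₀ = 0) {ν : Eucl n} (hν : ‖ν‖ = 1)
    (hfree : ∀ δ : ℝ, 0 < δ → ∃ y ∈ ball z₀ δ, ⟪ν, y - z₀⟫_ℝ = 0 ∧ 0 < u y)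
    (hthin : ∀ x ∈ ball z₀ r, ⟪ν, x - z₀⟫_ℝ = 0 → 0 ≤ u x)
    (hweak : ∀ (ψ : Eucl n → ℝ) (C : ℝ≥0), LipschitzWith C ψ → tsupport ψ ⊆ ball z₀ r →
      (∀ x ∈ ball z₀ r, ⟪ν, x - z₀⟫_ℝ = 0 → 0 ≤ u x + ψ x) →
      0 ≤ ∫ x, weakIntegrand F F₀ u ψ x) :
    ∃ a : ℝ, ∀ κ : ℝ, 0 < κ → ∃ δ : ℝ, 0 < δ ∧ ∀ x ∈ ball z₀ δ,
      |u x - a * ⟪ν, x - z₀⟫_ℝ| ≤ κ * ‖x - z₀‖ := by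
  have hsup : ∀ e : Eucl n, WeakSupersolution F F₀ u (ball z₀ r ∩ {x | 0 < ⟪e, x - z₀⟫_ℝ}) :=
    fun e ψ C hψ hs hψ0 => hweak ψ C hψ (hs.trans Set.inter_subset_left)
      fun x hx hxν => add_nonneg (hthin x hx hxν) (hψ0 x)
  obtain ⟨a, ha⟩ := exists_linear_expansion hF hell hr hr0 hr1 hu huz hν hthin (hsup ν)
  obtain ⟨b', hb'⟩ := exists_linear_expansion hF hell hr hr0 hr1 hu huz (ν := -ν)
    (by rwa [norm_neg]) (fun x hx hxν => hthin x hx (by rwa [inner_neg_left, neg_eq_zero] at hxν))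
    (hsup (-ν))
  obtain ⟨b, rfl⟩ : ∃ b, b' = -b := ⟨-b', (neg_neg b').symm⟩
  have hexp : ∀ κ : ℝ, 0 < κ → ∃ δ : ℝ, 0 < δ ∧ ∀ x ∈ ball z₀ δ,
      (0 ≤ ⟪ν, x - z₀⟫_ℝ → |u x - a * ⟪ν, x - z₀⟫_ℝ| ≤ κ * ‖x - z₀‖) ∧
      (⟪ν, x - z₀⟫_ℝ ≤ 0 → |u x - b * ⟪ν, x - z₀⟫_ℝ| ≤ κ * ‖x - z₀‖) := by
    intro κ hκ
    obtain ⟨δ₁, hδ₁, h₁⟩ := ha κ hκ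
    obtain ⟨δ₂, hδ₂, h₂⟩ := hb' κ hκ
    refine ⟨min δ₁ δ₂, lt_min hδ₁ hδ₂, fun x hx => ⟨fun h => ?_, fun h => ?_⟩⟩
    · exact h₁ x (ball_subset_ball (min_le_left _ _) hx) h
    · have := h₂ x (ball_subset_ball (min_le_right _ _) hx)
        (by rw [inner_neg_left]; exact neg_nonneg.2 h)
      rwa [inner_neg_left, neg_mul_neg] at this
  rcases lt_trichotomy a b with hab | rfl | hba
  · exfalso
    have hexp' : ∀ κ : ℝ, 0 < κ → ∃ δ : ℝ, 0 < δ ∧ ∀ x ∈ ball z₀ δ,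
        (0 ≤ ⟪ν, x - z₀⟫_ℝ → |-u x - -a * ⟪ν, x - z₀⟫_ℝ| ≤ κ * ‖x - z₀‖) ∧
        (⟪ν, x - z₀⟫_ℝ ≤ 0 → |-u x - -b * ⟪ν, x - z₀⟫_ℝ| ≤ κ * ‖x - z₀‖) := by
      intro κ hκ
      obtain ⟨δ, hδ, h⟩ := hexp κ hκ
      refine ⟨δ, hδ, fun x hx => ?_⟩
      have h1 : -u x - -a * ⟪ν, x - z₀⟫_ℝ = -(u x - a * ⟪ν, x - z₀⟫_ℝ) := by ring
      have h2 : -u x - -b * ⟪ν, x - z₀⟫_ℝ = -(u x - b * ⟪ν, x - z₀⟫_ℝ) := by ring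
      rw [h1, h2, abs_neg, abs_neg]
      exact h x hx
    obtain ⟨θ, hθ, δ, hδ, hδr, hkink⟩ := exists_kink_bound hF.reflected (hell.reflected hF) hr hr0
      (w := fun x => -u x) hu.neg hν (neg_lt_neg hab) hexp'
    obtain ⟨y, hy, hyν, huy⟩ := hfree (δ / 4) (by positivity)
    have hy' := mem_ball_iff_norm.1 hy
    have := hkink (δ / 2) (by positivity) (by linarith) y hyν (by linarith) 0 le_rfl hθ.le ?_
    · linarith
    intro ψ C hψ hs hψ0 hψη
    rw [weakIntegrand_reflected]
    refine hweak _ C hψ.neg ?_ ?_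
    · rw [show (fun x => -ψ x) = -ψ from rfl, tsupport_neg]
      exact hs.trans (ball_subset_ball (by linarith))
    · intro x hx hxν
      have h1 := hψη x hxν
      rw [zero_mul, zero_sub, neg_neg, max_eq_left (hthin x hx hxν)] at h1
      linarith
  · refine ⟨a, fun κ hκ => ?_⟩
    obtain ⟨δ, hδ, h⟩ := hexp κ hκ
    exact ⟨δ, hδ, fun x hx => (le_total 0 ⟪ν, x - z₀⟫_ℝ).elim (h x hx).1 (h x hx).2⟩
  · exfalso
    obtain ⟨θ, hθ, δ, hδ, hδr, hkink⟩ := exists_kink_bound hF hell hr hr0 hu hν hba hexp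
    have := hkink (δ / 2) (by positivity) (by linarith) z₀ (by simp) (by simp; positivity) θ hθ.le
      le_rfl fun ψ C hψ hs hψ0 _ => hweak ψ C hψ
        (hs.trans (ball_subset_ball (by linarith))) fun x hx hxν =>
          add_nonneg (hthin x hx hxν) (hψ0 x)
    rw [huz] at this
    have : 0 < θ * (δ / 2) := by positivity
    linarith

theorem norm_eLast : ‖eLast n‖ = 1 := by
  simp [eLast]

theorem inner_eLast (x : Eucl n) : ⟪eLast n, x⟫_ℝ = x (Fin.last n) := by
  simp [eLast, EuclideanSpace.inner_single_left]

theorem gradient_congr {u w : Eucl n → ℝ} {Ω : Set (Eucl n)} (hΩ : IsOpen Ω)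
    (huw : Set.EqOn u w Ω) {x : Eucl n} (hx : x ∈ Ω) : gradient u x = gradient w x := by
  have : u =ᶠ[𝓝 x] w := huw.eventuallyEq_of_mem (hΩ.mem_nhds hx)
  simp only [gradient, this.fderiv_eq]

/-- The first variation of the obstacle problem in a direction supported in the open domain is the
weak formulation. -/
theorem setIntegral_variation_eq (F : Eucl n → ℝ → Eucl n → Eucl n)
    (F₀ : Eucl n → ℝ → Eucl n → ℝ) {u w ψ : Eucl n → ℝ} {Ω : Set (Eucl n)} (hΩ : IsOpen Ω)
    (huw : Set.EqOn u w Ω) {L C : ℝ≥0} (hw : LipschitzWith L w) (hψ : LipschitzWith C ψ)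
    (hs : tsupport ψ ⊆ Ω) :
    ∫ x in Ω, (⟪F x (u x) (gradient u x), gradient (fun y => u y + ψ y) x - gradient u x⟫_ℝ +
      F₀ x (u x) (gradient u x) * ((u x + ψ x) - u x)) = ∫ x, weakIntegrand F F₀ w ψ x := by
  rw [← setIntegral_eq_integral_of_forall_compl_eq_zero (s := Ω) (f := weakIntegrand F F₀ w ψ)]
  · refine setIntegral_congr_ae hΩ.measurableSet ?_
    filter_upwards [hw.ae_differentiableAt (μ := volume), hψ.ae_differentiableAt (μ := volume)]
      with x hwx hψx hx
    have huψ : Set.EqOn (fun y => u y + ψ y) (fun y => w y + ψ y) Ω := fun y hy => by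
      simp only [huw hy]
    rw [gradient_congr hΩ huψ hx, gradient_congr hΩ huw hx, huw hx, add_sub_cancel_left]
    have : gradient (fun y => w y + ψ y) x = gradient w x + gradient ψ x := by
      simp only [gradient, fderiv_fun_add hwx hψx, map_add]
    rw [this, add_sub_cancel_left, weakIntegrand]
  · intro x hx
    have hx' : x ∉ tsupport ψ := fun h => hx (hs h)
    simp [weakIntegrand, gradient_eq_zero_of_notMem_tsupport hx',
      image_eq_zero_of_notMem_tsupport hx']

/-- A first order expansion gives uniform convergence of the rescalings and differentiability. -/
theorem tendstoUniformlyOn_and_hasGradientWithinAt {u : Eucl n → ℝ} {z₀ : Eucl n} {a : ℝ}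
    {S D D' : Set (Eucl n)} (hz : z₀ (Fin.last n) = 0) (huz : u z₀ = 0)
    (hexp : ∀ κ : ℝ, 0 < κ → ∃ δ : ℝ, 0 < δ ∧ ∀ x ∈ ball z₀ δ, x ∈ S →
      |u x - a * x (Fin.last n)| ≤ κ * ‖x - z₀‖)
    (hD : D ⊆ ball 0 1) (hDS : ∀ x ∈ D, ∀ t : ℝ, 0 < t → z₀ + t • x ∈ S) (hD' : D' ⊆ S) :
    TendstoUniformlyOn (fun (t : ℝ) (x : Eucl n) => u (z₀ + t • x) / t)
        (fun x : Eucl n => a * x (Fin.last n)) (𝓝[>] (0 : ℝ)) D ∧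
      HasGradientWithinAt u (a • eLast n) D' z₀ := by
  constructor
  · rw [Metric.tendstoUniformlyOn_iff]
    intro ε hε
    obtain ⟨δ, hδ, h⟩ := hexp (ε / 2) (by positivity)
    filter_upwards [Ioo_mem_nhdsGT hδ] with t ht x hx
    have ht0 : 0 < t := ht.1
    have hx1 : ‖x‖ < 1 := by simpa using hD hx
    have htx : ‖t • x‖ ≤ t := by
      rw [norm_smul, Real.norm_eq_abs, abs_of_pos ht0]
      exact mul_le_of_le_one_right ht0.le hx1.le
    have h1 := h (z₀ + t • x) (by
      rw [mem_ball_iff_norm, add_sub_cancel_left]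
      exact htx.trans_lt ht.2) (hDS x hx t ht0)
    rw [add_sub_cancel_left, PiLp.add_apply, PiLp.smul_apply, hz, zero_add, smul_eq_mul] at h1
    have h2 : u (z₀ + t • x) / t - a * x (Fin.last n) =
        (u (z₀ + t • x) - a * (t * x (Fin.last n))) / t := by
      field_simp
    rw [dist_comm, Real.dist_eq, h2, abs_div, abs_of_pos ht0, div_lt_iff₀ ht0]
    calc _ ≤ ε / 2 * ‖t • x‖ := h1
      _ ≤ ε / 2 * t := by gcongr
      _ < ε * t := by gcongr; linarith
  · rw [hasGradientWithinAt_iff_isLittleO, Asymptotics.isLittleO_iff]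
    intro κ hκ
    obtain ⟨δ, hδ, h⟩ := hexp κ hκ
    filter_upwards [mem_nhdsWithin_of_mem_nhds (ball_mem_nhds z₀ hδ), self_mem_nhdsWithin]
      with x hx hxD
    have := h x hx (hD' hxD)
    rwa [huz, sub_zero, inner_smul_left, inner_eLast, PiLp.sub_apply, hz, sub_zero,
      Real.norm_eq_abs]

theorem ThinSolution.exists_expansion {F : Eucl n → ℝ → Eucl n → Eucl n}
    {F₀ : Eucl n → ℝ → Eucl n → ℝ} {g u : Eucl n → ℝ} (hF : H0 F F₀) (hell : H1 F)
    (hu : ThinSolution F F₀ g u) {z₀ : Eucl n} (hz : z₀ ∈ freeBoundary u) :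
    ∃ a : ℝ, ∀ κ : ℝ, 0 < κ → ∃ δ : ℝ, 0 < δ ∧ ∀ x ∈ ball z₀ δ,
      |u x - a * x (Fin.last n)| ≤ κ * ‖x - z₀‖ := by
  obtain ⟨⟨⟨hzB, hz0⟩, huz⟩, hfree⟩ := hz
  obtain ⟨⟨⟨C, hC⟩, hg, hpos⟩, hvar⟩ := hu
  obtain ⟨w, hw, huw⟩ := hC.extend_real
  obtain ⟨r', hr'0, hr'⟩ := nhds_basis_closedBall.mem_iff.1 (isOpen_ball.mem_nhds hzB)
  have hr : closedBall z₀ (min r' 1) ⊆ ball 0 1 :=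
    (closedBall_subset_closedBall (min_le_left _ _)).trans hr'
  have hr0 : 0 < min r' 1 := lt_min hr'0 one_pos
  have hin : ∀ x, ⟪eLast n, x - z₀⟫_ℝ = x (Fin.last n) := fun x => by
    rw [inner_eLast, PiLp.sub_apply, hz0, sub_zero]
  have huwb : Set.EqOn u w (ball 0 1) := huw.mono ball_subset_closedBall
  have hthin : ∀ x ∈ ball (0 : Eucl n) 1, ⟪eLast n, x - z₀⟫_ℝ = 0 → 0 ≤ w x := fun x hx hx0 => by
    rw [← huwb hx]
    exact hpos x ⟨hx, by rwa [hin] at hx0⟩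
  obtain ⟨a, ha⟩ := exists_linear_expansion_thin hF hell hr hr0 (min_le_right _ _) hw
    (by rw [← huwb hzB, huz]) norm_eLast
    (fun δ hδ => by
      obtain ⟨y, hyt, hyδ, hy⟩ := hfree δ hδ
      exact ⟨y, hyδ, by rw [hin]; exact hyt.2, by rwa [← huwb hyt.1]⟩)
    (fun x hx => hthin x (hr (ball_subset_closedBall hx)))
    (fun ψ Cψ hψ hs hψ0 => by
      have hs' : tsupport ψ ⊆ ball 0 1 := hs.trans (ball_subset_closedBall.trans hr)
      rw [← setIntegral_variation_eq F F₀ isOpen_ball huwb hw hψ hs']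
      refine hvar (fun y => u y + ψ y)
        ⟨⟨C + Cψ, hC.add hψ.lipschitzOnWith⟩, fun x hx => ?_, fun x hx => ?_⟩
      · have : x ∉ tsupport ψ := fun h => by
          have h1 := mem_ball_zero_iff.1 (hs' h)
          rw [mem_sphere_zero_iff_norm.1 hx] at h1
          exact lt_irrefl _ h1
        simp only [image_eq_zero_of_notMem_tsupport this, add_zero, hg x hx]
      · by_cases hxr : x ∈ ball z₀ (min r' 1)
        · have := hψ0 x hxr (by rw [hin]; exact hx.2)
          rwa [← huwb hx.1] at this
        · have : x ∉ tsupport ψ := fun h => hxr (hs h)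
          simpa only [image_eq_zero_of_notMem_tsupport this, add_zero] using hpos x hx)
  refine ⟨a, fun κ hκ => ?_⟩
  obtain ⟨δ, hδ, h⟩ := ha κ hκ
  refine ⟨min δ (min r' 1), lt_min hδ hr0, fun x hx => ?_⟩
  have hxB : x ∈ ball (0 : Eucl n) 1 :=
    hr (ball_subset_closedBall (ball_subset_ball (min_le_right _ _) hx))
  have := h x (ball_subset_ball (min_le_left _ _) hx)
  rwa [hin, ← huwb hxB] at this

theorem BdrySolution.exists_expansion {F : Eucl n → ℝ → Eucl n → Eucl n}
    {F₀ : Eucl n → ℝ → Eucl n → ℝ} {g u : Eucl n → ℝ} (hF : H0 F F₀) (hell : H1 F)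
    (hu : BdrySolution F F₀ g u) {z₀ : Eucl n} (hz : z₀ ∈ coincidenceSet u) :
    ∃ a : ℝ, ∀ κ : ℝ, 0 < κ → ∃ δ : ℝ, 0 < δ ∧ ∀ x ∈ ball z₀ δ, 0 ≤ x (Fin.last n) →
      |u x - a * x (Fin.last n)| ≤ κ * ‖x - z₀‖ := by
  obtain ⟨⟨hzB, hz0⟩, huz⟩ := hz
  obtain ⟨⟨⟨C, hC⟩, hg, hpos⟩, hvar⟩ := hu
  obtain ⟨w, hw, huw⟩ := hC.extend_real
  obtain ⟨r', hr'0, hr'⟩ := nhds_basis_closedBall.mem_iff.1 (isOpen_ball.mem_nhds hzB)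
  have hr : closedBall z₀ (min r' 1) ⊆ ball 0 1 :=
    (closedBall_subset_closedBall (min_le_left _ _)).trans hr'
  have hr0 : 0 < min r' 1 := lt_min hr'0 one_pos
  have hin : ∀ x, ⟪eLast n, x - z₀⟫_ℝ = x (Fin.last n) := fun x => by
    rw [inner_eLast, PiLp.sub_apply, hz0, sub_zero]
  have hopen : IsOpen (hBall (0 : Eucl n) 1) :=
    isOpen_ball.inter (isOpen_lt continuous_const (by fun_prop))
  have huwb : Set.EqOn u w (hBall 0 1) := fun x hx =>
    huw ⟨ball_subset_closedBall hx.1, (show 0 < x (Fin.last n) from hx.2).le⟩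
  have hthin : ∀ x ∈ ball (0 : Eucl n) 1, ⟪eLast n, x - z₀⟫_ℝ = 0 → 0 ≤ w x := fun x hx hx0 => by
    rw [hin] at hx0
    rw [← huw ⟨ball_subset_closedBall hx, hx0.ge⟩]
    exact hpos x ⟨hx, hx0⟩
  obtain ⟨a, ha⟩ := exists_linear_expansion hF hell hr hr0 (min_le_right _ _) hw
    (by rw [← huw ⟨ball_subset_closedBall hzB, hz0.ge⟩, huz]) norm_eLast
    (fun x hx => hthin x (hr (ball_subset_closedBall hx)))
    (fun ψ Cψ hψ hs hψ0 => by
      have hs' : tsupport ψ ⊆ hBall 0 1 := fun x hx => by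
        obtain ⟨h1, h2⟩ := hs hx
        exact ⟨hr (ball_subset_closedBall h1), by rwa [Set.mem_ofPred_eq, hin] at h2⟩
      rw [← setIntegral_variation_eq F F₀ hopen huwb hw hψ hs']
      refine hvar (fun y => u y + ψ y)
        ⟨⟨C + Cψ, hC.add hψ.lipschitzOnWith⟩, fun x hx hx0 => ?_,
          fun x hx => add_nonneg (hpos x hx) (hψ0 x)⟩
      have : x ∉ tsupport ψ := fun h => by
        have h1 := mem_ball_zero_iff.1 (hs' h).1
        rw [hx] at h1
        exact lt_irrefl _ h1
      simp only [image_eq_zero_of_notMem_tsupport this, add_zero, hg x hx hx0])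
  refine ⟨a, fun κ hκ => ?_⟩
  obtain ⟨δ, hδ, h⟩ := ha κ hκ
  refine ⟨min δ (min r' 1), lt_min hδ hr0, fun x hx hx0 => ?_⟩
  have hxB : x ∈ closedBall (0 : Eucl n) 1 := ball_subset_closedBall
    (hr (ball_subset_closedBall (ball_subset_ball (min_le_right _ _) hx)))
  have := h x (ball_subset_ball (min_le_left _ _) hx) (by rwa [hin])
  rwa [hin, ← huw ⟨hxB, hx0⟩] at this

end TOP

open TOP in
/-- Proposition: uniqueness of blowups and differentiability.
For a Lipschitz solution of either the thin obstacle problem (domain `D = B₁`,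
`D' = B₁`) or the boundary obstacle problem (`D = B₁⁺`, `D' = B₁⁺ ∪ B₁'`), at every
free boundary point `z₀` the rescalings `u(z₀ + t x)/t` converge uniformly on `D` as
`t → 0⁺` to a unique linear blowup `a x_{n+1}`; in particular `u` is differentiable at
`z₀` relative to its domain with gradient `(0, a)`. -/
theorem blowup_uniqueness_and_differentiability {n : ℕ}
    (F : Eucl n → ℝ → Eucl n → Eucl n) (F₀ : Eucl n → ℝ → Eucl n → ℝ)
    (g u : Eucl n → ℝ) (D D' : Set (Eucl n))
    (hF : H0 F F₀) (hell : H1 F)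
    (hcase :
      (ThinSolution F F₀ g u ∧ D = Metric.ball (0 : Eucl n) 1 ∧
        D' = Metric.ball (0 : Eucl n) 1) ∨
      (BdrySolution F F₀ g u ∧ D = hBall (0 : Eucl n) 1 ∧
        D' = hBall (0 : Eucl n) 1 ∪ tBall (0 : Eucl n) 1)) :
    ∀ z₀ ∈ freeBoundary u, ∃ a : ℝ,
      TendstoUniformlyOn (fun (t : ℝ) (x : Eucl n) => u (z₀ + t • x) / t)
        (fun x : Eucl n => a * x (Fin.last n)) (𝓝[>] (0 : ℝ)) D ∧
      HasGradientWithinAt u (a • eLast n) D' z₀ := by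
  intro z₀ hz
  have hz0 : z₀ (Fin.last n) = 0 := hz.1.1.2
  rcases hcase with ⟨hu, rfl, rfl⟩ | ⟨hu, rfl, rfl⟩
  · obtain ⟨a, ha⟩ := hu.exists_expansion hF hell hz
    exact ⟨a, tendstoUniformlyOn_and_hasGradientWithinAt (S := Set.univ) hz0 hz.1.2
      (fun κ hκ => (ha κ hκ).imp fun δ h => ⟨h.1, fun x hx _ => h.2 x hx⟩) subset_rfl
      (fun _ _ _ _ => trivial) (Set.subset_univ _)⟩
  · obtain ⟨a, ha⟩ := hu.exists_expansion hF hell hz.1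
    refine ⟨a, tendstoUniformlyOn_and_hasGradientWithinAt (S := {x | 0 ≤ x (Fin.last n)}) hz0
      hz.1.2 ha Set.inter_subset_left (fun x hx t ht => ?_) ?_⟩
    · have hx0 : 0 < x (Fin.last n) := hx.2
      rw [Set.mem_ofPred_eq, PiLp.add_apply, PiLp.smul_apply, hz0, zero_add, smul_eq_mul]
      positivity
    · rintro x (hx | hx)
      · have hx0 : 0 < x (Fin.last n) := hx.2
        exact hx0.le
      · have hx0 : x (Fin.last n) = 0 := hx.2
        exact hx0.ge
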